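/- arXiv:math/0612292 — 2 statements merged into one kernel-verified Lean document; each statement's English description precedes it below -/
import Mathlib

section
/- The symmetric group S_4 has exactly two table automorphisms; that is, the set of pairs (σ, τ) that are table automorphisms of S_4 has exactly two elements. -/
/-- `f : G → ℂ` is an irreducible character of `G` if it is the character of some
irreducible (simple) finite-dimensional complex representation of `G`. -/
def IsIrrChar (G : Type) [Group G] (f : G → ℂ) : Prop :=
  ∃ V : FDRep ℂ G, CategoryTheory.Simple V ∧ f = V.character

/-- `(σ, τ)` is a table automorphism of `G`: `σ` permutes the irreducible characters,
`τ` permutes the conjugacy classes, and for every irreducible character `f`, every `g`,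
and every `h` whose conjugacy class is `τ` of the class of `g`, `(σ f) h = f g`. -/
def IsTableAut (G : Type) [Group G]
    (σ : Equiv.Perm {f : G → ℂ // IsIrrChar G f})
    (τ : Equiv.Perm (ConjClasses G)) : Prop :=
  ∀ (f : {f : G → ℂ // IsIrrChar G f}) (g h : G),
    ConjClasses.mk h = τ (ConjClasses.mk g) → (σ f).1 h = f.1 g

open Equiv

/-- A finite-dimensional integral matrix representation whose character has norm one affords an
irreducible complex character. -/
theorem isIrrChar_of_matrix {G : Type} [Group G] [Fintype G] {n : ℕ}
    (M : G →* Matrix (Fin n) (Fin n) ℤ)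
    (hM : ∑ g, (M g).trace * (M g⁻¹).trace = Fintype.card G) :
    IsIrrChar G fun g => ((M g).trace : ℂ) := by
  let ρ : Representation ℂ G (Fin n → ℂ) :=
    (Matrix.toLinAlgEquiv' (R := ℂ) (n := Fin n)).toMonoidHom.comp
      ((Int.castRingHom ℂ).mapMatrix.toMonoidHom.comp M)
  have hρ (g : G) : (FDRep.of ρ).character g = ((M g).trace : ℂ) := by
    change LinearMap.trace ℂ _ (Matrix.toLin' ((M g).map (Int.castRingHom ℂ))) = _
    rw [Matrix.trace_toLin'_eq]
    simp [Matrix.trace]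
  refine ⟨FDRep.of ρ, ?_, funext fun g => (hρ g).symm⟩
  rw [FDRep.simple_iff_char_is_norm_one]
  simp only [hρ, Nat.card_eq_fintype_card]
  exact_mod_cast hM

/-- Distinct irreducible characters of a finite group are orthogonal. -/
theorem IsIrrChar.sum_mul_inv_eq_zero {G : Type} [Group G] [Fintype G] {f f' : G → ℂ}
    (hf : IsIrrChar G f) (hf' : IsIrrChar G f') (hne : f ≠ f') :
    ∑ g, f g * f' g⁻¹ = 0 := by
  obtain ⟨V, hV, rfl⟩ := hf
  obtain ⟨W, hW, rfl⟩ := hf'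
  have hcard : (Nat.card G : ℂ) ≠ 0 := by simp
  have := invertibleOfNonzero hcard
  have h := FDRep.char_orthonormal V W
  rw [if_neg fun ⟨i⟩ => hne (FDRep.char_iso i)] at h
  exact (mul_eq_zero.mp h).resolve_left (inv_ne_zero hcard)

theorem IsIrrChar.apply_one_ne_zero {G : Type} [Group G] [Finite G] {f : G → ℂ}
    (hf : IsIrrChar G f) : f 1 ≠ 0 := by
  have := Fintype.ofFinite G
  obtain ⟨V, hV, rfl⟩ := hf
  intro h
  rw [FDRep.char_one, Nat.cast_eq_zero] at h
  have hsub : Subsingleton V := Module.finrank_zero_iff.mp h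
  have h0 (g : G) : V.character g = 0 := by
    rw [FDRep.character, Subsingleton.elim (V.ρ g) 0, map_zero]
  have h1 := (FDRep.simple_iff_char_is_norm_one V).mp hV
  simp [h0, eq_comm] at h1

theorem IsIrrChar.apply_eq_of_isConj {G : Type} [Group G] {f : G → ℂ}
    (hf : IsIrrChar G f) {g h : G} (hgh : IsConj g h) : f g = f h := by
  obtain ⟨V, -, rfl⟩ := hf
  obtain ⟨c, rfl⟩ := isConj_iff.mp hgh
  exact (FDRep.char_conj V g c).symm

/-- Twist of an integral matrix representation of a symmetric group by the sign character. -/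
def signTwist {n m : ℕ} (M : Perm (Fin n) →* Matrix (Fin m) (Fin m) ℤ) :
    Perm (Fin n) →* Matrix (Fin m) (Fin m) ℤ where
  toFun g := (Perm.sign g : ℤ) • M g
  map_one' := by simp
  map_mul' g h := by
    simp only [map_mul, Units.val_mul, Matrix.smul_mul, Matrix.mul_smul, smul_smul, mul_comm]

/-- The standard representation of `S_4`, in the basis `e_i - e_3` of the vectors of sum zero. -/
def standardMatrix : Perm (Fin 4) →* Matrix (Fin 3) (Fin 3) ℤ where
  toFun g := .of fun i j =>
    (if g j.castSucc = i.castSucc then 1 else 0) - if g 3 = i.castSucc then 1 else 0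
  map_one' := by decide +kernel
  map_mul' := by decide +kernel

/-- The two-dimensional representation of `S_4`, given by its action on the three partitions of
`Fin 4` into pairs. The partition having `{a, b}` as a block is labelled by `a ^^^ b`. -/
def pairingMatrix : Perm (Fin 4) →* Matrix (Fin 2) (Fin 2) ℤ where
  toFun g := .of fun i j =>
    (if g j.succ.castSucc ^^^ g 0 = i.succ.castSucc then 1 else 0) -
      if g 3 ^^^ g 0 = i.succ.castSucc then 1 else 0
  map_one' := by decide +kernel
  map_mul' := by decide +kernel

/-- The five irreducible characters of `S_4`. -/
def charS4 (i : Fin 5) (g : Perm (Fin 4)) : ℤ :=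
  (![(1 : Matrix (Fin 1) (Fin 1) ℤ).trace, (signTwist (m := 1) 1 g).trace,
    (pairingMatrix g).trace, (standardMatrix g).trace,
    (signTwist standardMatrix g).trace] : Fin 5 → ℤ) i

/-- Representatives of the five conjugacy classes of `S_4`. -/
def classRepS4 : Fin 5 → Perm (Fin 4) :=
  ![1, c[0, 1], c[0, 1] * c[2, 3], c[0, 1, 2], c[0, 1, 2, 3]]

/-- The character table of `S_4`. -/
def tableS4 : Fin 5 → Fin 5 → ℤ :=
  ![![1, 1, 1, 1, 1], ![1, -1, 1, 1, -1], ![2, 0, 2, -1, 0], ![3, 1, -1, 0, -1], ![3, -1, -1, 0, 1]]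

theorem charS4_classRepS4 : ∀ i j, charS4 i (classRepS4 j) = tableS4 i j := by decide +kernel

theorem exists_isConj_classRepS4 : ∀ g, ∃ j, IsConj (classRepS4 j) g := by decide +kernel

theorem tableS4_injective : Function.Injective tableS4 := by decide +kernel

theorem tableS4_column_injective : ∀ j k, (∀ i, tableS4 i j = tableS4 i k) → j = k := by
  decide +kernel

theorem tableS4_column_sum : ∀ j, ∑ i, tableS4 i j = ∑ i, tableS4 i 0 → j = 0 := by
  decide +kernel

theorem tableS4_perm_of_degree_eq : ∀ p : Perm (Fin 5), (∀ i, tableS4 (p i) 0 = tableS4 i 0) →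
    ∀ q : Perm (Fin 5), (∀ i j, tableS4 (p i) (q j) = tableS4 i j) →
      (p = 1 ∧ q = 1) ∨ (p = swap 3 4 ∧ q = swap 1 4) := by
  decide +kernel

theorem tableS4_perm_iff (p q : Perm (Fin 5)) :
    (∀ i j, tableS4 (p i) (q j) = tableS4 i j) ↔
      (p = 1 ∧ q = 1) ∨ (p = swap 3 4 ∧ q = swap 1 4) := by
  constructor
  · intro h
    have hq : q 0 = 0 := tableS4_column_sum _ <| by
      rw [← Equiv.sum_comp p]
      exact Finset.sum_congr rfl fun i _ => h i 0
    exact tableS4_perm_of_degree_eq p (fun i => by simpa only [hq] using h i 0) q h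
  · rintro (⟨rfl, rfl⟩ | ⟨rfl, rfl⟩)
    · exact fun _ _ => rfl
    · decide +kernel

theorem sum_charS4_one_mul : ∀ g, ∑ i, charS4 i 1 * charS4 i g⁻¹ = if g = 1 then 24 else 0 := by
  decide +kernel

theorem sum_charS4_mul_inv : ∀ i, ∑ g, charS4 i g * charS4 i g⁻¹ = Fintype.card (Perm (Fin 4)) := by
  decide +kernel

theorem isIrrChar_charS4 (i : Fin 5) : IsIrrChar (Perm (Fin 4)) fun g => (charS4 i g : ℂ) := by
  have h := sum_charS4_mul_inv i
  fin_cases i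
  exacts [isIrrChar_of_matrix (n := 1) 1 h, isIrrChar_of_matrix (signTwist 1) h,
    isIrrChar_of_matrix pairingMatrix h, isIrrChar_of_matrix standardMatrix h,
    isIrrChar_of_matrix (signTwist standardMatrix) h]

theorem IsIrrChar.exists_eq_charS4 {f : Perm (Fin 4) → ℂ} (hf : IsIrrChar (Perm (Fin 4)) f) :
    ∃ i, (fun g => (charS4 i g : ℂ)) = f := by
  by_contra! hne
  have h : ∑ i, (charS4 i 1 : ℂ) * ∑ g, f g * charS4 i g⁻¹ = 24 * f 1 := by
    have hg (g : Perm (Fin 4)) : ∑ i, (charS4 i 1 : ℂ) * charS4 i g⁻¹ = if g = 1 then 24 else 0 := by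
      exact_mod_cast congrArg (Int.cast : ℤ → ℂ) (sum_charS4_one_mul g)
    simp_rw [Finset.mul_sum]
    rw [Finset.sum_comm]
    simp_rw [mul_left_comm _ (f _), ← Finset.mul_sum, hg]
    simp [mul_comm]
  have h0 (i : Fin 5) := hf.sum_mul_inv_eq_zero (isIrrChar_charS4 i) (hne i).symm
  simp only [h0, mul_zero, Finset.sum_const_zero] at h
  exact hf.apply_one_ne_zero (by simpa using h.symm)

/-- The irreducible characters of `S_4`, indexed by the rows of its character table. -/
noncomputable def irrEquivS4 :
    Fin 5 ≃ {f : Perm (Fin 4) → ℂ // IsIrrChar (Perm (Fin 4)) f} :=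
  .ofBijective (fun i => ⟨fun g => (charS4 i g : ℂ), isIrrChar_charS4 i⟩) <| by
    refine ⟨fun i j hij => tableS4_injective (funext fun k => ?_), fun f => ?_⟩
    · rw [← charS4_classRepS4, ← charS4_classRepS4]
      exact Int.cast_injective (α := ℂ) (congrFun (congrArg Subtype.val hij) (classRepS4 k))
    · obtain ⟨i, hi⟩ := f.2.exists_eq_charS4
      exact ⟨i, Subtype.ext hi⟩

theorem charS4_eq_of_isConj (i : Fin 5) {g h : Perm (Fin 4)} (hgh : IsConj g h) :
    charS4 i g = charS4 i h := by
  exact_mod_cast (isIrrChar_charS4 i).apply_eq_of_isConj hgh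

/-- The conjugacy classes of `S_4`, indexed by the columns of its character table. -/
noncomputable def classEquivS4 : Fin 5 ≃ ConjClasses (Perm (Fin 4)) :=
  .ofBijective (fun j => ConjClasses.mk (classRepS4 j)) <| by
    refine ⟨fun j k hjk => tableS4_column_injective j k fun i => ?_, fun c => ?_⟩
    · rw [← charS4_classRepS4, ← charS4_classRepS4]
      exact charS4_eq_of_isConj i (ConjClasses.mk_eq_mk_iff_isConj.mp hjk)
    · obtain ⟨g, rfl⟩ := ConjClasses.mk_surjective c
      obtain ⟨j, hj⟩ := exists_isConj_classRepS4 g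
      exact ⟨j, ConjClasses.mk_eq_mk_iff_isConj.mpr hj⟩

theorem charS4_of_mk_eq {g : Perm (Fin 4)} {j : Fin 5} (h : ConjClasses.mk g = classEquivS4 j)
    (i : Fin 5) : charS4 i g = tableS4 i j := by
  rw [charS4_eq_of_isConj i (ConjClasses.mk_eq_mk_iff_isConj.mp h), charS4_classRepS4]

theorem isTableAut_permCongr_iff (p q : Perm (Fin 5)) :
    IsTableAut (Perm (Fin 4)) (irrEquivS4.permCongr p) (classEquivS4.permCongr q) ↔
      ∀ i j, tableS4 (p i) (q j) = tableS4 i j := by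
  constructor
  · intro H i j
    have h := H (irrEquivS4 i) (classRepS4 j) (classRepS4 (q j)) (by
      change classEquivS4 (q j) = classEquivS4.permCongr q (classEquivS4 j)
      simp)
    simp only [permCongr_apply, symm_apply_apply] at h
    rw [← charS4_classRepS4, ← charS4_classRepS4]
    exact Int.cast_injective (α := ℂ) h
  · intro H f g h hgh
    obtain ⟨i, rfl⟩ := irrEquivS4.surjective f
    obtain ⟨j, hj⟩ := classEquivS4.surjective (ConjClasses.mk g)
    rw [← hj, permCongr_apply, symm_apply_apply] at hgh
    rw [permCongr_apply, symm_apply_apply]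
    change (charS4 (p i) h : ℂ) = charS4 i g
    rw [charS4_of_mk_eq hgh, charS4_of_mk_eq hj.symm, H]

theorem table_auts_S4_card_two :
    Set.ncard {p : Equiv.Perm {f : Equiv.Perm (Fin 4) → ℂ // IsIrrChar (Equiv.Perm (Fin 4)) f} ×
        Equiv.Perm (ConjClasses (Equiv.Perm (Fin 4))) |
        IsTableAut (Equiv.Perm (Fin 4)) p.1 p.2} = 2 := by
  let e := irrEquivS4.permCongr.prodCongr classEquivS4.permCongr
  rw [← Set.ncard_preimage_of_injective_subset_range e.injective (by simp [e.surjective.range_eq])]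
  have h : e ⁻¹' {p | IsTableAut (Perm (Fin 4)) p.1 p.2} = {(1, 1), (swap 3 4, swap 1 4)} := by
    ext ⟨p, q⟩
    change IsTableAut _ (irrEquivS4.permCongr p) (classEquivS4.permCongr q) ↔ _
    rw [isTableAut_permCongr_iff, tableS4_perm_iff]
    simp
  rw [h, Set.ncard_pair]
  decide
end

section
/- Let n be a natural number with n ≠ 4. Then every table automorphism of S_n is induced by a group automorphism: if (σ, τ) is a table automorphism of S_n, then there exists a group automorphism φ of S_n such that for every g ∈ S_n, τ(conjugacy class of g) = conjugacy class of φ(g), and for every irreducible character f of S_n and every g ∈ S_n, (σ f)(g) = f(φ⁻¹(g)). -/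
section Characters

open CategoryTheory MonoidAlgebra

variable {G : Type} [Group G]

/-- Schur's lemma for the action of a class function on a simple representation. -/
lemma FDRep.exists_sum_smul_eq_smul_id [Fintype G] (V : FDRep ℂ G) [Simple V] (F : G → ℂ)
    (hF : ∀ g k : G, F (k * g * k⁻¹) = F g) :
    ∃ c : ℂ, ∑ g, F g • V.ρ g = c • LinearMap.id := by
  set E : V →ₗ[ℂ] V := ∑ g, F g • V.ρ g with hE
  have hcomm : ∀ k : G, V.ρ k * E = E * V.ρ k := by
    intro k
    rw [hE, Finset.mul_sum, Finset.sum_mul,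
      ← (MulAut.conj k⁻¹).toEquiv.sum_comp (fun g => V.ρ k * F g • V.ρ g)]
    refine Finset.sum_congr rfl fun g _ => ?_
    have : F (k⁻¹ * (g * k)) = F g := by simpa [mul_assoc] using hF g k⁻¹
    simp [this, ← map_mul, mul_assoc]
  let e : V ⟶ V := ⟨InducedCategory.homMk (ModuleCat.ofHom E), fun g => by
    ext x
    exact (LinearMap.congr_fun (hcomm g) x).symm⟩
  obtain ⟨c, hc⟩ := (finrank_eq_one_iff_of_nonzero' (𝟙 V) (id_nonzero V)).mp
    (finrank_endomorphism_simple_eq_one ℂ V) e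
  refine ⟨c, ?_⟩
  ext x
  have := congrArg (fun f : V ⟶ V => f.hom.hom.hom x) hc
  exact this.symm

lemma FDRep.sum_mul_char_mul [Fintype G] (V : FDRep ℂ G) [Simple V] (F : G → ℂ)
    (hF : ∀ g k : G, F (k * g * k⁻¹) = F g) (x : G) :
    (∑ g, F g * V.character (g * x)) * V.character 1 =
      (∑ g, F g * V.character g) * V.character x := by
  obtain ⟨c, hc⟩ := V.exists_sum_smul_eq_smul_id F hF
  have key : ∀ x, ∑ g, F g * V.character (g * x) = c * V.character x := by
    intro x
    have := congrArg (fun f : V →ₗ[ℂ] V => LinearMap.trace ℂ V (f * V.ρ x)) hc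
    simpa [Finset.sum_mul, FDRep.character, ← map_mul, ← Module.End.one_eq_id] using this
  have h1 := key 1
  simp only [mul_one] at h1
  rw [key, h1]; ring

lemma IsIrrChar.conj {f : G → ℂ} (hf : IsIrrChar G f) (g k : G) : f (k * g * k⁻¹) = f g := by
  obtain ⟨V, -, rfl⟩ := hf
  exact V.char_conj g k

lemma IsIrrChar.exists_one_eq {f : G → ℂ} (hf : IsIrrChar G f) : ∃ d : ℕ, 0 < d ∧ f 1 = d := by
  obtain ⟨V, hV, rfl⟩ := hf
  refine ⟨_, ?_, V.char_one⟩
  rw [Module.finrank_pos_iff]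
  by_contra h
  rw [not_nontrivial_iff_subsingleton] at h
  apply id_nonzero V
  ext x
  exact Subsingleton.elim (α := V) _ _

lemma IsIrrChar.sum_mul_inv [Fintype G] [DecidableEq (G → ℂ)] {f f' : G → ℂ} (hf : IsIrrChar G f)
    (hf' : IsIrrChar G f') :
    ∑ g, f g * f' g⁻¹ = if f = f' then (Fintype.card G : ℂ) else 0 := by
  classical
  obtain ⟨V, hV, rfl⟩ := hf
  obtain ⟨W, hW, rfl⟩ := hf'
  have hcard : (Nat.card G : ℂ) ≠ 0 := by simp
  have := invertibleOfNonzero hcard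
  have h1 := FDRep.char_orthonormal V W
  have h2 := FDRep.char_orthonormal V V
  rw [if_pos ⟨Iso.refl V⟩] at h2
  by_cases h : V.character = W.character
  · rw [if_pos h, ← h]
    rw [inv_mul_eq_one₀ hcard] at h2
    rw [← h2]; simp
  · rw [if_neg h]
    rw [if_neg (fun ⟨i⟩ => h (FDRep.char_iso i))] at h1
    exact (mul_eq_zero.mp h1).resolve_left (inv_ne_zero hcard)

lemma IsIrrChar.sum_inv_mul [Fintype G] [DecidableEq (G → ℂ)] {f f' : G → ℂ}
    (hf : IsIrrChar G f) (hf' : IsIrrChar G f') (x : G) :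
    (∑ g, f g * f' (g⁻¹ * x)) * f 1 = if f = f' then (Fintype.card G : ℂ) * f x else 0 := by
  have h := hf'.sum_mul_inv hf
  have hf1 := hf'
  obtain ⟨V, hV, rfl⟩ := hf1
  have := V.sum_mul_char_mul (fun g => f g⁻¹) (fun g k => by
    have := hf.conj g⁻¹ k
    simpa [mul_assoc] using this) x
  rw [← Equiv.sum_comp (Equiv.inv G)]
  simp only [Equiv.inv_apply, inv_inv]
  simp only [mul_comm (f _⁻¹) (V.character _)] at this
  simp only [mul_comm (f _⁻¹) (V.character _)]
  rw [h] at this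
  by_cases hh : f = V.character
  · subst hh
    simpa using this
  · rw [if_neg hh]
    rw [if_neg (Ne.symm hh)] at this
    obtain ⟨d, hd, hd'⟩ := hf'.exists_one_eq
    have hne : V.character 1 ≠ 0 := by rw [hd']; exact_mod_cast hd.ne'
    rw [zero_mul] at this
    rw [(mul_eq_zero.mp this).resolve_right hne, zero_mul]

lemma Representation.asAlgebraHom_ofModule'_apply {M : Type*} [AddCommGroup M] [Module ℂ M]
    [Module (MonoidAlgebra ℂ G) M] [IsScalarTower ℂ (MonoidAlgebra ℂ G) M]
    (r : MonoidAlgebra ℂ G) (m : M) :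
    (Representation.ofModule' (k := ℂ) (G := G) M).asAlgebraHom r m = r • m := by
  exact LinearMap.congr_fun (AlgHom.congr_fun
    ((MonoidAlgebra.lift ℂ (M →ₗ[ℂ] M) G).apply_symm_apply (Algebra.lsmul ℂ ℂ M)) r) m

lemma Representation.isIrreducible_ofModule' {M : Type*} [AddCommGroup M] [Module ℂ M]
    [Module (MonoidAlgebra ℂ G) M] [IsScalarTower ℂ (MonoidAlgebra ℂ G) M]
    [IsSimpleModule (MonoidAlgebra ℂ G) M] :
    (Representation.ofModule' (k := ℂ) (G := G) M).IsIrreducible := by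
  rw [Representation.irreducible_iff_isSimpleModule_asModule]
  let e : (Representation.ofModule' (k := ℂ) (G := G) M).asModule ≃ₗ[MonoidAlgebra ℂ G] M :=
    { (Representation.ofModule' (k := ℂ) (G := G) M).asModuleEquiv with
      map_smul' := fun r x => by
        have := Representation.asModuleEquiv_map_smul (Representation.ofModule' M) r x
        rw [Representation.asAlgebraHom_ofModule'_apply] at this
        exact this }
  exact IsSimpleModule.congr e

lemma MonoidAlgebra.sum_single_smul_eq_zero [Fintype G] (F : G → ℂ)
    (hF : ∀ g k : G, F (k * g * k⁻¹) = F g)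
    (h : ∀ f, IsIrrChar G f → ∑ g, F g * f g = 0)
    (M : Type) [AddCommGroup M] [Module ℂ M] [Module (MonoidAlgebra ℂ G) M]
    [IsScalarTower ℂ (MonoidAlgebra ℂ G) M] [IsSimpleModule (MonoidAlgebra ℂ G) M] (x : M) :
    (∑ g, MonoidAlgebra.single g (F g) : MonoidAlgebra ℂ G) • x = 0 := by
  have : Invertible (Nat.card G : ℂ) := invertibleOfNonzero (by simp)
  have : Module.Finite ℂ M := Module.Finite.trans (MonoidAlgebra ℂ G) _
  have hirr := Representation.isIrreducible_ofModule' (G := G) (M := M)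
  have key := Representation.asAlgebraHom_ofModule'_apply (G := G) (M := M)
  generalize Representation.ofModule' (k := ℂ) (G := G) M = ρ at hirr key
  let V : FDRep ℂ G := FDRep.of ρ
  have hV : Simple V := by
    rw [FDRep.simple_iff_char_is_norm_one]
    have := Representation.char_orthonormal ρ ρ
    rw [if_pos ⟨Representation.Equiv.refl ρ⟩, inv_mul_eq_one₀ (by simp)] at this
    exact this.symm
  obtain ⟨c, hc⟩ := V.exists_sum_smul_eq_smul_id F hF
  have hc0 : c = 0 := by
    have := congrArg (fun f : V →ₗ[ℂ] V => LinearMap.trace ℂ V f) hc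
    have h2 := h V.character ⟨V, hV, rfl⟩
    obtain ⟨d, hd, hd'⟩ := IsIrrChar.exists_one_eq ⟨V, hV, rfl⟩
    rw [FDRep.char_one] at hd'
    simp only [map_sum, map_smul, smul_eq_mul, LinearMap.trace_id] at this
    rw [hd'] at this
    have h3 : c * (d : ℂ) = 0 := this.symm.trans h2
    exact (mul_eq_zero.mp h3).resolve_right (by exact_mod_cast hd.ne')
  rw [hc0, zero_smul] at hc
  have h4 : ρ.asAlgebraHom (∑ g, MonoidAlgebra.single g (F g)) = 0 := by
    simp only [map_sum, Representation.asAlgebraHom_single]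
    exact hc
  rw [← key, h4, LinearMap.zero_apply]

/-- A class function orthogonal to all irreducible characters vanishes. -/
lemma eq_zero_of_forall_sum_irrChar_eq_zero [Fintype G] (F : G → ℂ)
    (hF : ∀ g k : G, F (k * g * k⁻¹) = F g)
    (h : ∀ f, IsIrrChar G f → ∑ g, F g * f g = 0) : F = 0 := by
  classical
  have : NeZero (Nat.card G : ℂ) := ⟨by simp⟩
  set z : MonoidAlgebra ℂ G := ∑ g, MonoidAlgebra.single g (F g) with hz
  have hz0 : z = 0 := by
    have hjac : Ring.jacobson (MonoidAlgebra ℂ G) = ⊥ := IsSemisimpleModule.jacobson_eq_bot _ _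
    rw [← Submodule.mem_bot (R := MonoidAlgebra ℂ G), ← hjac, Ring.jacobson_eq_sInf_isMaximal,
      Submodule.mem_sInf]
    intro m hm
    have hm' : IsSimpleModule (MonoidAlgebra ℂ G) (MonoidAlgebra ℂ G ⧸ m) :=
      isSimpleModule_iff_isCoatom.2 (Ideal.isMaximal_def.1 hm)
    have := MonoidAlgebra.sum_single_smul_eq_zero F hF h (MonoidAlgebra ℂ G ⧸ m)
      (Submodule.Quotient.mk 1)
    rw [← hz, ← Submodule.Quotient.mk_smul, Submodule.Quotient.mk_eq_zero] at this
    simpa using this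
  funext g
  have := congrArg (fun w : MonoidAlgebra ℂ G => w.coeff g) hz0
  simpa [hz, Finsupp.single_apply] using this

/-- The irreducible characters span the class functions. -/
lemma mem_span_irrChar [Fintype G] (F : G → ℂ) (hF : ∀ g k : G, F (k * g * k⁻¹) = F g) :
    F ∈ Submodule.span ℂ {f | IsIrrChar G f} := by
  classical
  by_contra hmem
  obtain ⟨φ, hφF, hφ⟩ := Submodule.exists_le_ker_of_notMem hmem
  let a : G → ℂ := fun g => φ (Pi.single g 1)
  have hφa : ∀ H, φ H = ∑ g, a g * H g := fun H => by
    conv_lhs => rw [← Finset.univ_sum_single H]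
    rw [map_sum]
    refine Finset.sum_congr rfl fun g _ => ?_
    have : Pi.single (M := fun _ => ℂ) g (H g) = H g • Pi.single g 1 := by
      rw [← Pi.single_smul]; simp
    rw [this, map_smul, smul_eq_mul, mul_comm]
  let b : G → ℂ := fun g => ∑ k, a (k * g * k⁻¹)
  have hb : ∀ H : G → ℂ, (∀ g k : G, H (k * g * k⁻¹) = H g) →
      ∑ g, b g * H g = Fintype.card G * φ H := by
    intro H hH
    simp only [b, Finset.sum_mul]
    rw [Finset.sum_comm]
    have : ∀ k ∈ (Finset.univ : Finset G), ∑ g, a (k * g * k⁻¹) * H g = φ H := by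
      intro k _
      rw [hφa, ← Equiv.sum_comp (MulAut.conj k).toEquiv (fun g => a g * H g)]
      refine Finset.sum_congr rfl fun g _ => ?_
      simp only [MulEquiv.toEquiv_eq_coe, EquivLike.coe_coe, MulAut.conj_apply, hH]
    rw [Finset.sum_congr rfl this]
    simp
  have hb0 : b = 0 := by
    refine eq_zero_of_forall_sum_irrChar_eq_zero b (fun g k => ?_) fun f hf => ?_
    · simp only [b]
      rw [← Equiv.sum_comp (Equiv.mulRight k) (fun x => a (x * g * x⁻¹))]
      simp [mul_assoc]
    · rw [hb f hf.conj, show φ f = 0 from hφ (Submodule.subset_span hf), mul_zero]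
  have := hb F hF
  rw [hb0] at this
  simp only [Pi.zero_apply, zero_mul, Finset.sum_const_zero] at this
  rcases mul_eq_zero.mp this.symm with h | h
  · simp at h
  · exact hφF h

lemma IsTableAut.map_one [Finite G] {σ : Equiv.Perm {f : G → ℂ // IsIrrChar G f}}
    {τ : Equiv.Perm (ConjClasses G)} (h : IsTableAut G σ τ) :
    τ (ConjClasses.mk 1) = ConjClasses.mk 1 := by
  classical
  have := Fintype.ofFinite G
  obtain ⟨k, hk⟩ := ConjClasses.exists_rep (τ (ConjClasses.mk 1))
  rw [← hk]
  suffices k = 1 by rw [this]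
  by_contra hk1
  obtain ⟨l, hl⟩ := (Finsupp.mem_span_iff_linearCombination ℂ _ _).1
    (mem_span_irrChar (Pi.single (1 : G) (1 : ℂ)) fun g k => by
      simp only [Pi.single_apply, mul_inv_eq_one, mul_eq_left])
  have hl' : ∀ g, ∑ f ∈ l.support, l f * f.1 g = Pi.single (M := fun _ => ℂ) 1 1 g := by
    intro g
    rw [← hl, Finsupp.linearCombination_apply, Finsupp.sum, Finset.sum_apply]
    simp
  have hcoef : ∀ f ∈ l.support, l f * (Fintype.card G : ℂ) = f.1 1 := by
    intro f hf
    have h1 : ∑ g, (Pi.single (M := fun _ => ℂ) 1 1 g) * f.1 g⁻¹ = f.1 1 := by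
      simp [Pi.single_apply]
    rw [← h1]
    simp only [← hl', Finset.sum_mul]
    rw [Finset.sum_comm]
    simp only [mul_assoc, ← Finset.mul_sum]
    rw [Finset.sum_eq_single_of_mem f hf]
    · rw [f.2.sum_mul_inv f.2, if_pos rfl]
    · intro f' _ hne
      rw [f'.2.sum_mul_inv f.2, if_neg (fun e => hne (Subtype.ext e)), mul_zero]
  have hne : l.support.Nonempty := by
    by_contra hemp
    rw [Finset.not_nonempty_iff_eq_empty] at hemp
    have := hl' 1
    simp [hemp] at this
  have hpos : 0 < (∑ f ∈ l.support, l f * f.1 k).re := by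
    rw [Complex.re_sum]
    refine Finset.sum_pos (fun f hf => ?_) hne
    obtain ⟨d, hd, hd'⟩ := f.2.exists_one_eq
    obtain ⟨e, he, he'⟩ := (σ.symm f).2.exists_one_eq
    have hfk : f.1 k = e := by
      rw [← he', ← h (σ.symm f) 1 k hk, Equiv.apply_symm_apply]
    have hlf : l f = ((d / Fintype.card G : ℝ) : ℂ) := by
      have := hcoef f hf
      rw [hd'] at this
      push_cast
      rw [eq_div_iff (by simp), this]
    rw [hfk, hlf, ← Complex.ofReal_natCast, ← Complex.ofReal_mul, Complex.ofReal_re]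
    have := Fintype.card_pos (α := G)
    positivity
  rw [hl' k, Pi.single_eq_of_ne hk1] at hpos
  simp at hpos

/-- The permutation `τ` of the conjugacy classes is compatible with the convolution of
class functions, hence with the structure constants of the class algebra. -/
def PreservesConvolution [Fintype G] (τ : Equiv.Perm (ConjClasses G)) : Prop :=
  ∀ (F H : ConjClasses G → ℚ) (x y : G), ConjClasses.mk y = τ (ConjClasses.mk x) →
    ∑ g : G, F (τ (ConjClasses.mk g)) * H (τ (ConjClasses.mk (g⁻¹ * x))) =
      ∑ g : G, F (ConjClasses.mk g) * H (ConjClasses.mk (g⁻¹ * y))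

lemma exists_linearCombination_irrChar [Finite G] (F : ConjClasses G → ℂ) :
    ∃ l : {f : G → ℂ // IsIrrChar G f} →₀ ℂ,
      ∀ g, F (ConjClasses.mk g) = l.sum fun f c => c * f.1 g := by
  have := Fintype.ofFinite G
  obtain ⟨l, hl⟩ := (Finsupp.mem_span_iff_linearCombination ℂ _ _).1
    (mem_span_irrChar (fun g : G => F (ConjClasses.mk g)) fun g k => by
      congr 1
      exact ConjClasses.mk_eq_mk_iff_isConj.2 (isConj_iff.2 ⟨k⁻¹, by group⟩))
  refine ⟨l, fun g => ?_⟩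
  have := congrFun hl g
  rw [Finsupp.linearCombination_apply, Finsupp.sum, Finset.sum_apply] at this
  simp only [Pi.smul_apply, smul_eq_mul] at this
  exact this.symm

lemma IsTableAut.preservesConvolution [Fintype G]
    {σ : Equiv.Perm {f : G → ℂ // IsIrrChar G f}}
    {τ : Equiv.Perm (ConjClasses G)} (h : IsTableAut G σ τ) : PreservesConvolution τ := by
  classical
  have hone : ∀ f, (σ f).1 1 = f.1 1 := fun f => h f 1 1 h.map_one.symm
  have key : ∀ (f f' : {f : G → ℂ // IsIrrChar G f}) (x y : G),
      ConjClasses.mk y = τ (ConjClasses.mk x) →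
      ∑ g, f.1 g * f'.1 (g⁻¹ * x) = ∑ g, (σ f).1 g * (σ f').1 (g⁻¹ * y) := by
    intro f f' x y hxy
    obtain ⟨d, hd, hd'⟩ := f.2.exists_one_eq
    have hne : f.1 1 ≠ 0 := by rw [hd']; exact_mod_cast hd.ne'
    have h1 := f.2.sum_inv_mul f'.2 x
    have h2 := (σ f).2.sum_inv_mul (σ f').2 y
    rw [hone] at h2
    rw [← mul_left_inj' hne, h1, h2, h f x y hxy]
    simp only [← Subtype.ext_iff, EmbeddingLike.apply_eq_iff_eq]
  have hC : ∀ (F H : ConjClasses G → ℂ) (x y : G), ConjClasses.mk y = τ (ConjClasses.mk x) →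
      ∑ g : G, F (τ (ConjClasses.mk g)) * H (τ (ConjClasses.mk (g⁻¹ * x))) =
        ∑ g : G, F (ConjClasses.mk g) * H (ConjClasses.mk (g⁻¹ * y)) := by
    intro F H x y hxy
    obtain ⟨l, hl⟩ := exists_linearCombination_irrChar (F ∘ τ)
    obtain ⟨m, hm⟩ := exists_linearCombination_irrChar (H ∘ τ)
    have tr : ∀ (F : ConjClasses G → ℂ) (l : {f : G → ℂ // IsIrrChar G f} →₀ ℂ),
        (∀ g, (F ∘ τ) (ConjClasses.mk g) = l.sum fun f c => c * f.1 g) →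
        ∀ g, F (ConjClasses.mk g) = l.sum fun f c => c * (σ f).1 g := by
      intro F l hl g
      obtain ⟨k, hk⟩ := ConjClasses.exists_rep (τ.symm (ConjClasses.mk g))
      have hk' : ConjClasses.mk g = τ (ConjClasses.mk k) := by rw [hk, Equiv.apply_symm_apply]
      rw [hk']
      refine (hl k).trans (Finsupp.sum_congr fun f _ => ?_)
      rw [h f k g hk']
    have e1 : ∀ g, F (τ (ConjClasses.mk g)) = l.sum fun f c => c * f.1 g := hl
    have e2 : ∀ g, H (τ (ConjClasses.mk g)) = m.sum fun f c => c * f.1 g := hm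
    simp only [e1, e2, tr F l hl, tr H m hm, Finsupp.sum, Finset.sum_mul_sum]
    rw [Finset.sum_comm]
    conv_rhs => rw [Finset.sum_comm]
    refine Finset.sum_congr rfl fun f _ => ?_
    rw [Finset.sum_comm]
    conv_rhs => rw [Finset.sum_comm]
    refine Finset.sum_congr rfl fun f' _ => ?_
    simp only [mul_mul_mul_comm _ _ (m f'), ← Finset.mul_sum]
    rw [key f f' x y hxy]
  intro F H x y hxy
  have := hC (fun c => (F c : ℂ)) (fun c => (H c : ℂ)) x y hxy
  exact_mod_cast this

end Characters

section PreservesConvolution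

variable {G : Type} [Group G]

lemma PreservesConvolution.trans [Fintype G] {τ τ' : Equiv.Perm (ConjClasses G)}
    (h : PreservesConvolution τ) (h' : PreservesConvolution τ') :
    PreservesConvolution (τ.trans τ') := by
  intro F H x y hxy
  obtain ⟨z, hz⟩ := ConjClasses.exists_rep (τ (ConjClasses.mk x))
  have := h (F ∘ τ') (H ∘ τ') x z hz
  refine Eq.trans this (h' F H z y ?_)
  rw [hxy, hz]; rfl

/-- The permutation of the conjugacy classes induced by an automorphism. -/
def MulEquiv.conjClasses (φ : G ≃* G) : Equiv.Perm (ConjClasses G) where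
  toFun := ConjClasses.map (φ : G →* G)
  invFun := ConjClasses.map (φ.symm : G →* G)
  left_inv c := by
    obtain ⟨g, rfl⟩ := ConjClasses.exists_rep c
    change ConjClasses.mk (φ.symm (φ g)) = _
    simp
  right_inv c := by
    obtain ⟨g, rfl⟩ := ConjClasses.exists_rep c
    change ConjClasses.mk (φ (φ.symm g)) = _
    simp

lemma MulEquiv.conjClasses_mk (φ : G ≃* G) (g : G) :
    φ.conjClasses (ConjClasses.mk g) = ConjClasses.mk (φ g) := rfl

lemma MulEquiv.preservesConvolution_conjClasses [Fintype G] (φ : G ≃* G) :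
    PreservesConvolution φ.conjClasses := by
  intro F H x y hxy
  simp only [MulEquiv.conjClasses_mk] at *
  obtain ⟨k, hk⟩ := isConj_iff.1 (ConjClasses.mk_eq_mk_iff_isConj.1 hxy)
  have hconj : ∀ g k : G, ConjClasses.mk (k * g * k⁻¹) = ConjClasses.mk g := fun g k =>
    ConjClasses.mk_eq_mk_iff_isConj.2 (isConj_iff.2 ⟨k⁻¹, by group⟩)
  rw [← Equiv.sum_comp (φ.trans (MulAut.conj k⁻¹)).toEquiv
    (fun g => F (ConjClasses.mk g) * H (ConjClasses.mk (g⁻¹ * y)))]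
  refine Finset.sum_congr rfl fun g _ => ?_
  have e : ((φ.trans (MulAut.conj k⁻¹)) g)⁻¹ * y = k⁻¹ * φ (g⁻¹ * x) * k⁻¹⁻¹ := by
    rw [map_mul, ← hk]
    simp [mul_assoc]
  have e' : (φ.trans (MulAut.conj k⁻¹)) g = k⁻¹ * φ g * k⁻¹⁻¹ := by simp
  change _ = F (ConjClasses.mk ((φ.trans (MulAut.conj k⁻¹)) g)) *
    H (ConjClasses.mk (((φ.trans (MulAut.conj k⁻¹)) g)⁻¹ * y))
  rw [e, e', hconj, hconj]

lemma PreservesConvolution.card_eq [Fintype G] {τ : Equiv.Perm (ConjClasses G)}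
    (h : PreservesConvolution τ) (c : ConjClasses G) :
    Nat.card {g : G | ConjClasses.mk g = c} = Nat.card {g : G | ConjClasses.mk g = τ c} := by
  classical
  obtain ⟨y, hy⟩ := ConjClasses.exists_rep (τ (ConjClasses.mk 1))
  have := h (fun d => if d = τ c then 1 else 0) (fun _ => 1) 1 y hy
  simp only [EmbeddingLike.apply_eq_iff_eq, mul_one, Finset.sum_boole] at this
  simp only [Nat.card_eq_fintype_card, Fintype.card_subtype, Set.coe_ofPred]
  exact_mod_cast this

/-- A function on `G` is invariant under `τ` if it takes the same values on `c` and `τ c`,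
for every conjugacy class `c`. -/
def ClassInvariant {R : Type*} (τ : Equiv.Perm (ConjClasses G)) (F : G → R) : Prop :=
  ∀ x y, ConjClasses.mk y = τ (ConjClasses.mk x) → F x = F y

lemma ClassInvariant.eq_of_mk_eq {R : Type*} {τ : Equiv.Perm (ConjClasses G)} {F : G → R}
    (hF : ClassInvariant τ F) {x y : G} (h : ConjClasses.mk x = ConjClasses.mk y) : F x = F y := by
  obtain ⟨z, hz⟩ := ConjClasses.exists_rep (τ.symm (ConjClasses.mk x))
  rw [← hF z x (by simp [hz]), ← hF z y (by simp [hz, h])]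

lemma ClassInvariant.conv [Fintype G] {τ : Equiv.Perm (ConjClasses G)}
    (hτ : PreservesConvolution τ) {F H : G → ℚ} (hF : ClassInvariant τ F)
    (hH : ClassInvariant τ H) : ClassInvariant τ fun x => ∑ g, F g * H (g⁻¹ * x) := by
  have hmk : ∀ c : ConjClasses G, ConjClasses.mk (Quotient.out c) = c := Quotient.out_eq
  intro x y hxy
  convert hτ (fun c => F (Quotient.out c)) (fun c => H (Quotient.out c)) x y hxy using 2 with g _ g _
  · rw [hF _ _ (hmk (τ (ConjClasses.mk g))), hH _ _ (hmk (τ (ConjClasses.mk (g⁻¹ * x))))]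
  · rw [hF.eq_of_mk_eq (hmk (ConjClasses.mk g)), hH.eq_of_mk_eq (hmk (ConjClasses.mk (g⁻¹ * y)))]

end PreservesConvolution


section Transpositions

open Equiv Finset
open Function (minimalPeriod)

variable {α : Type} [Fintype α] [DecidableEq α]

lemma ClassInvariant.sum_swap_mul {τ : Perm (ConjClasses (Perm α))} (hτ : PreservesConvolution τ)
    (hT : ∀ s : Perm α, s.IsSwap → τ (ConjClasses.mk s) = ConjClasses.mk s) {F : Perm α → ℚ}
    (hF : ClassInvariant τ F) :
    ClassInvariant τ fun x => ∑ a, ∑ b, if a ≠ b then F (swap a b * x) else 0 := by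
  set W : Perm α → ℚ := fun s => ∑ a, ∑ b, if a ≠ b ∧ swap a b = s then 1 else 0 with hWdef
  have hW0 : ∀ s : Perm α, ¬ s.IsSwap → W s = 0 := by
    intro s hs
    refine Finset.sum_eq_zero fun a _ => Finset.sum_eq_zero fun b _ => if_neg ?_
    rintro ⟨hab, rfl⟩
    exact hs ⟨a, b, hab, rfl⟩
  have hWconj : ∀ s k : Perm α, W (k * s * k⁻¹) = W s := by
    intro s k
    simp only [hWdef]
    rw [← Equiv.sum_comp k]
    refine Finset.sum_congr rfl fun a _ => ?_
    rw [← Equiv.sum_comp k]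
    refine Finset.sum_congr rfl fun b _ => ?_
    have : swap (k a) (k b) = k * swap a b * k⁻¹ := by
      rw [Equiv.mul_swap_eq_swap_mul, mul_assoc, mul_inv_cancel, mul_one]
    simp [this]
  have hWmk : ∀ s t : Perm α, ConjClasses.mk s = ConjClasses.mk t → W s = W t := by
    intro s t h
    obtain ⟨k, rfl⟩ := isConj_iff.mp (ConjClasses.mk_eq_mk_iff_isConj.mp h)
    exact (hWconj s k).symm
  have hW : ClassInvariant τ W := by
    intro x y hxy
    by_cases hx : x.IsSwap
    · rw [hT x hx] at hxy
      exact (hWmk y x hxy).symm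
    · by_cases hy : y.IsSwap
      · rw [← hT y hy] at hxy
        exact (hWmk y x (τ.injective hxy)).symm
      · rw [hW0 x hx, hW0 y hy]
  have key : ∀ x, ∑ g, W g * F (g⁻¹ * x) = ∑ a, ∑ b, if a ≠ b then F (swap a b * x) else 0 := by
    intro x
    simp only [hWdef, Finset.sum_mul]
    rw [Finset.sum_comm]
    refine Finset.sum_congr rfl fun a _ => ?_
    rw [Finset.sum_comm]
    refine Finset.sum_congr rfl fun b _ => ?_
    by_cases hab : a = b
    · simp [hab]
    · simp [hab]
  have := ClassInvariant.conv hτ hW hF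
  simpa only [key] using this

lemma Equiv.Perm.minimalPeriod_pos {α : Type*} [Finite α] (g : Perm α) (x : α) : 0 < minimalPeriod g x :=
  Function.minimalPeriod_pos_of_mem_periodicPts (g.injective.mem_periodicPts x)

lemma Equiv.Perm.pow_minimalPeriod_apply {α : Type*} (g : Perm α) (x : α) :
    (g ^ minimalPeriod g x) x = x := by
  rw [← Equiv.Perm.iterate_eq_pow]
  exact Function.iterate_minimalPeriod

lemma Equiv.Perm.pow_apply_inj_of_lt {α : Type*} {g : Perm α} {x : α} {i j : ℕ} (hi : i < minimalPeriod g x)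
    (hj : j < minimalPeriod g x) : (g ^ i) x = (g ^ j) x ↔ i = j := by
  rw [← Equiv.Perm.iterate_eq_pow, ← Equiv.Perm.iterate_eq_pow]
  exact Function.iterate_eq_iterate_iff_of_lt_minimalPeriod hi hj

lemma Equiv.Perm.minimalPeriod_pow_apply {α : Type*} [Finite α] (g : Perm α) (x : α) (i : ℕ) :
    minimalPeriod g ((g ^ i) x) = minimalPeriod g x := by
  rw [← Equiv.Perm.iterate_eq_pow]
  exact Function.minimalPeriod_apply_iterate (g.injective.mem_periodicPts x) i

lemma Equiv.Perm.sameCycle_iff_exists_pow_lt_minimalPeriod {α : Type*} [Finite α] {g : Perm α} {x y : α} :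
    g.SameCycle x y ↔ ∃ i < minimalPeriod g x, (g ^ i) x = y := by
  constructor
  · intro h
    obtain ⟨i, -, hi⟩ := h.exists_pow_eq'
    refine ⟨i % minimalPeriod g x, Nat.mod_lt _ (g.minimalPeriod_pos x), ?_⟩
    rw [← hi, ← Equiv.Perm.iterate_eq_pow, ← Equiv.Perm.iterate_eq_pow]
    exact Function.iterate_mod_minimalPeriod_eq
  · rintro ⟨i, -, hi⟩
    exact ⟨i, by simpa using hi⟩

/-- Multiplying `g` by the transposition of `a` and `g ^ j a` turns `a, …, g ^ (j - 1) a` into a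
cycle of length `j`. -/
lemma Equiv.Perm.minimalPeriod_swap_mul {g : Perm α} {a : α} {j : ℕ} (hj : 0 < j)
    (hjm : j < minimalPeriod g a) {i : ℕ} (hi : i < j) :
    minimalPeriod (swap a ((g ^ j) a) * g) ((g ^ i) a) = j := by
  set g' := swap a ((g ^ j) a) * g with hg'
  have h1 : ∀ i < j, (g' ^ i) a = (g ^ i) a := by
    intro i
    induction i with
    | zero => simp
    | succ i ih =>
      intro hi
      rw [pow_succ', Perm.mul_apply, ih (by omega), hg', Perm.mul_apply, ← Perm.mul_apply g,
        ← pow_succ', swap_apply_of_ne_of_ne]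
      · intro h
        have := (pow_apply_inj_of_lt (g := g) (x := a) (i := i + 1) (j := 0) (by omega)
          (by omega)).1 (by simpa using h)
        omega
      · intro h
        have := (pow_apply_inj_of_lt (g := g) (x := a) (i := i + 1) (j := j) (by omega)
          (by omega)).1 h
        omega
  have h2 : (g' ^ j) a = a := by
    obtain ⟨k, rfl⟩ : ∃ k, j = k + 1 := ⟨j - 1, by omega⟩
    rw [pow_succ', Perm.mul_apply, h1 k (by omega), hg', Perm.mul_apply, ← Perm.mul_apply g,
      ← pow_succ', swap_apply_right]
  rw [← h1 i hi, minimalPeriod_pow_apply]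
  refine le_antisymm ?_ ?_
  · refine Function.IsPeriodicPt.minimalPeriod_le hj ?_
    rw [Function.IsPeriodicPt, Equiv.Perm.iterate_eq_pow]
    exact h2
  · by_contra! hlt
    have h3 := g'.pow_minimalPeriod_apply a
    rw [h1 _ hlt] at h3
    have := (pow_apply_inj_of_lt (g := g) (x := a)
      (i := minimalPeriod g' a) (j := 0) (by omega) (by omega)).1 (by simpa using h3)
    exact (g'.minimalPeriod_pos a).ne' this

lemma Equiv.Perm.minimalPeriod_swap_mul' {g : Perm α} {a : α} {j : ℕ} (hj : 0 < j)
    (hjm : j < minimalPeriod g a) {i : ℕ} (hji : j ≤ i) (hi : i < minimalPeriod g a) :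
    minimalPeriod (swap a ((g ^ j) a) * g) ((g ^ i) a) = minimalPeriod g a - j := by
  have hm := minimalPeriod_pow_apply g a j
  have hb : (g ^ (minimalPeriod g a - j)) ((g ^ j) a) = a := by
    rw [← Perm.mul_apply, ← pow_add, Nat.sub_add_cancel hjm.le, pow_minimalPeriod_apply]
  have := minimalPeriod_swap_mul (g := g) (a := (g ^ j) a) (j := minimalPeriod g a - j)
    (i := i - j) (by omega) (by omega) (by omega)
  rwa [hb, swap_comm, ← Perm.mul_apply, ← pow_add, Nat.sub_add_cancel hji] at this

lemma Equiv.Perm.minimalPeriod_swap_mul_of_not_sameCycle {α : Type*} [DecidableEq α] {g : Perm α} {a b x : α}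
    (hab : g.SameCycle a b) (hx : ¬ g.SameCycle a x) :
    minimalPeriod (swap a b * g) x = minimalPeriod g x := by
  have h1 : ∀ i, ((swap a b * g) ^ i) x = (g ^ i) x := by
    intro i
    induction i with
    | zero => simp
    | succ i ih =>
      have hx' : ¬ g.SameCycle a ((g ^ (i + 1)) x) := by rwa [sameCycle_pow_right]
      rw [pow_succ', Perm.mul_apply, ih, Perm.mul_apply, ← Perm.mul_apply g, ← pow_succ',
        swap_apply_of_ne_of_ne]
      · rintro h
        rw [h] at hx'
        exact hx' (SameCycle.refl _ _)
      · rintro h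
        rw [h] at hx'
        exact hx' hab
  rw [Function.minimalPeriod_eq_minimalPeriod_iff]
  intro i
  rw [Function.IsPeriodicPt, Function.IsPeriodicPt, iterate_eq_pow, iterate_eq_pow,
    Function.IsFixedPt, Function.IsFixedPt, h1]

/-- The sum of `h` over the cycle lengths of `g`, each cycle being counted once for each of its
points. -/
noncomputable def Equiv.Perm.periodSum (h : ℕ → ℚ) (g : Perm α) : ℚ := ∑ x, h (minimalPeriod g x)

lemma Equiv.Perm.sum_sameCycle (g : Perm α) (a : α) (f : α → ℚ) :
    ∑ x with g.SameCycle a x, f x = ∑ i ∈ range (minimalPeriod g a), f ((g ^ i) a) := by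
  rw [← Finset.sum_image (f := f) (g := fun i => (g ^ i) a)]
  · refine Finset.sum_congr ?_ fun _ _ => rfl
    ext x
    simp [sameCycle_iff_exists_pow_lt_minimalPeriod]
  · intro i hi j hj hij
    exact (pow_apply_inj_of_lt (by simpa using hi) (by simpa using hj)).1 hij

lemma Equiv.Perm.periodSum_swap_mul (h : ℕ → ℚ) {g : Perm α} {a : α} {j : ℕ} (hj : 0 < j)
    (hjm : j < minimalPeriod g a) :
    periodSum h (swap a ((g ^ j) a) * g) = periodSum h g - minimalPeriod g a * h (minimalPeriod g a)
      + j * h j + (minimalPeriod g a - j : ℕ) * h (minimalPeriod g a - j) := by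
  rw [periodSum, periodSum, ← Finset.sum_filter_add_sum_filter_not univ (fun x => g.SameCycle a x),
    ← Finset.sum_filter_add_sum_filter_not univ (fun x => g.SameCycle a x)
      (f := fun x => h (minimalPeriod g x)), sum_sameCycle, sum_sameCycle]
  have e1 : ∑ i ∈ range (minimalPeriod g a), h (minimalPeriod g ((g ^ i) a)) =
      minimalPeriod g a * h (minimalPeriod g a) := by
    simp [minimalPeriod_pow_apply]
  have e2 : ∑ i ∈ range (minimalPeriod g a),
      h (minimalPeriod (swap a ((g ^ j) a) * g) ((g ^ i) a)) =
      j * h j + (minimalPeriod g a - j : ℕ) * h (minimalPeriod g a - j) := by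
    rw [← Finset.sum_range_add_sum_Ico _ hjm.le]
    congr 1
    · rw [Finset.sum_congr rfl (g := fun _ => h j)]
      · simp
      · intro i hi
        rw [minimalPeriod_swap_mul hj hjm (by simpa using hi)]
    · rw [Finset.sum_congr rfl (g := fun _ => h (minimalPeriod g a - j))]
      · simp
      · intro i hi
        rw [Finset.mem_Ico] at hi
        rw [minimalPeriod_swap_mul' hj hjm hi.1 hi.2]
  have e3 : ∑ x with ¬ g.SameCycle a x, h (minimalPeriod (swap a ((g ^ j) a) * g) x) =
      ∑ x with ¬ g.SameCycle a x, h (minimalPeriod g x) := by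
    refine Finset.sum_congr rfl fun x hx => ?_
    rw [minimalPeriod_swap_mul_of_not_sameCycle ⟨j, by simp⟩ (by simpa using hx)]
  rw [e1, e2, e3]
  ring

lemma Equiv.Perm.sameCycle_swap_mul {g : Perm α} {a b : α} (h : ¬ g.SameCycle a b) :
    (swap a b * g).SameCycle a b := by
  have h1 : ∀ i < minimalPeriod g a, ((swap a b * g) ^ i) a = (g ^ i) a := by
    intro i
    induction i with
    | zero => simp
    | succ i ih =>
      intro hi
      rw [pow_succ', Perm.mul_apply, ih (by omega), Perm.mul_apply, ← Perm.mul_apply g,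
        ← pow_succ', swap_apply_of_ne_of_ne]
      · intro h
        have := (pow_apply_inj_of_lt (g := g) (x := a) (i := i + 1) (j := 0) (by omega)
          (by omega)).1 (by simpa using h)
        omega
      · rintro rfl
        exact h ⟨(i + 1 : ℕ), by simp only [zpow_natCast]⟩
  obtain ⟨k, hk⟩ : ∃ k, minimalPeriod g a = k + 1 :=
    ⟨minimalPeriod g a - 1, by have := g.minimalPeriod_pos a; omega⟩
  have h2 : ((swap a b * g) ^ (k + 1)) a = b := by
    rw [pow_succ', Perm.mul_apply, h1 k (by omega), Perm.mul_apply, ← Perm.mul_apply g,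
      ← pow_succ', ← hk, pow_minimalPeriod_apply, swap_apply_left]
  exact ⟨(k + 1 : ℕ), by simpa only [zpow_natCast] using h2⟩

/-- The number of cycles of `g`, fixed points included. -/
noncomputable def Equiv.Perm.cycleNum (g : Perm α) : ℚ := periodSum (fun m => (m : ℚ)⁻¹) g

lemma Equiv.Perm.cycleNum_swap_mul_of_sameCycle {g : Perm α} {a b : α} (hab : a ≠ b)
    (h : g.SameCycle a b) : cycleNum (swap a b * g) = cycleNum g + 1 := by
  obtain ⟨j, hj, rfl⟩ := sameCycle_iff_exists_pow_lt_minimalPeriod.1 h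
  have hj0 : 0 < j := by
    rcases j.eq_zero_or_pos with rfl | h0
    · simp at hab
    · exact h0
  rw [cycleNum, periodSum_swap_mul _ hj0 hj, cycleNum, mul_inv_cancel₀, mul_inv_cancel₀,
    mul_inv_cancel₀]
  · ring
  · exact_mod_cast (by omega : minimalPeriod g a - j ≠ 0)
  · exact_mod_cast hj0.ne'
  · exact_mod_cast (g.minimalPeriod_pos a).ne'

lemma Equiv.Perm.cycleNum_swap_mul_of_not_sameCycle {g : Perm α} {a b : α}
    (h : ¬ g.SameCycle a b) : cycleNum (swap a b * g) = cycleNum g - 1 := by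
  have hab : a ≠ b := by rintro rfl; exact h (SameCycle.refl _ _)
  have := cycleNum_swap_mul_of_sameCycle hab (sameCycle_swap_mul h)
  rw [← mul_assoc, swap_mul_self, one_mul] at this
  linarith

lemma Equiv.Perm.cycleNum_swap_mul_eq_iff {g : Perm α} {a b : α} (hab : a ≠ b) :
    cycleNum (swap a b * g) = cycleNum g + 1 ↔ g.SameCycle a b := by
  refine ⟨fun h => ?_, cycleNum_swap_mul_of_sameCycle hab⟩
  by_contra h'
  rw [cycleNum_swap_mul_of_not_sameCycle h'] at h
  linarith

lemma Equiv.Perm.cycleNum_le {α : Type} [Fintype α] [DecidableEq α] (g : Perm α) :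
    cycleNum g ≤ Fintype.card α := by
  have : ∀ x ∈ univ, (minimalPeriod g x : ℚ)⁻¹ ≤ 1 := fun x _ =>
    inv_le_one_of_one_le₀ (by exact_mod_cast g.minimalPeriod_pos x)
  simpa [cycleNum, periodSum] using Finset.sum_le_sum this

lemma Equiv.Perm.cycleNum_one {α : Type} [Fintype α] : cycleNum (1 : Perm α) = Fintype.card α := by
  simp [cycleNum, periodSum, Equiv.Perm.coe_one]

lemma Equiv.Perm.exists_cycleNum_eq (g : Perm α) : ∃ k : ℕ, cycleNum g + k = Fintype.card α := by
  have : ∃ z : ℤ, cycleNum g = z := by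
    induction g using Equiv.Perm.swap_induction_on with
    | one => exact ⟨Fintype.card α, by simp [cycleNum_one]⟩
    | swap_mul f a b hab ih =>
      obtain ⟨z, hz⟩ := ih
      by_cases h : f.SameCycle a b
      · exact ⟨z + 1, by rw [cycleNum_swap_mul_of_sameCycle hab h, hz]; push_cast; rfl⟩
      · exact ⟨z - 1, by rw [cycleNum_swap_mul_of_not_sameCycle h, hz]; push_cast; rfl⟩
  obtain ⟨z, hz⟩ := this
  have hle := g.cycleNum_le
  rw [hz] at hle
  have hle' : z ≤ Fintype.card α := by exact_mod_cast hle
  refine ⟨(Fintype.card α - z).toNat, ?_⟩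
  have : (((Fintype.card α - z).toNat : ℤ) : ℚ) = Fintype.card α - z := by
    rw [Int.toNat_of_nonneg (by omega)]; push_cast; rfl
  rw [hz, ← Int.cast_natCast (Fintype.card α - z).toNat, this]
  ring

lemma Equiv.Perm.exists_cycleNum_swap_mul {g : Perm α} (hg : g ≠ 1) :
    ∃ a b, a ≠ b ∧ cycleNum (swap a b * g) = cycleNum g + 1 := by
  obtain ⟨a, ha⟩ : ∃ a, a ≠ g a := by
    by_contra! h
    exact hg (Equiv.ext fun a => (h a).symm)
  exact ⟨a, g a, ha, cycleNum_swap_mul_of_sameCycle ha ⟨1, by simp⟩⟩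

lemma Equiv.Perm.eq_one_iff_card_le_cycleNum {g : Perm α} :
    g = 1 ↔ (Fintype.card α : ℚ) ≤ cycleNum g := by
  refine ⟨fun h => by rw [h, cycleNum_one], fun h => ?_⟩
  by_contra hg
  obtain ⟨a, b, -, hab⟩ := exists_cycleNum_swap_mul hg
  have := cycleNum_le (swap a b * g)
  linarith

lemma Equiv.Perm.card_le_cycleNum_add_succ_iff {g : Perm α} {k : ℕ} :
    (Fintype.card α : ℚ) ≤ cycleNum g + (k + 1 : ℕ) ↔ (Fintype.card α : ℚ) ≤ cycleNum g + k ∨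
      ∃ a b, a ≠ b ∧ (Fintype.card α : ℚ) ≤ cycleNum (swap a b * g) + k := by
  constructor
  · intro h
    by_cases hg : g = 1
    · left
      rw [hg, cycleNum_one]
      simp
    · right
      obtain ⟨a, b, hab, h'⟩ := exists_cycleNum_swap_mul hg
      refine ⟨a, b, hab, ?_⟩
      push_cast at h
      linarith
  · push_cast
    rintro (h | ⟨a, b, hab, h⟩)
    · linarith
    · by_cases h' : g.SameCycle a b
      · rw [cycleNum_swap_mul_of_sameCycle hab h'] at h
        linarith
      · rw [cycleNum_swap_mul_of_not_sameCycle h'] at h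
        linarith

section Invariance

variable {τ : Perm (ConjClasses (Perm α))}

lemma classInvariant_cycleNum (hτ : PreservesConvolution τ)
    (h1 : τ (ConjClasses.mk 1) = ConjClasses.mk 1)
    (hT : ∀ s : Perm α, s.IsSwap → τ (ConjClasses.mk s) = ConjClasses.mk s) :
    ClassInvariant τ (Equiv.Perm.cycleNum (α := α)) := by
  have hite : ∀ (p q : Prop) [Decidable p] [Decidable q],
      (if p then (1 : ℚ) else 0) = (if q then 1 else 0) → (p ↔ q) := by
    intro p q _ _ h
    by_cases p <;> by_cases q <;> simp_all
  have key : ∀ k : ℕ, ClassInvariant τ fun g : Perm α =>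
      if (Fintype.card α : ℚ) ≤ g.cycleNum + k then (1 : ℚ) else 0 := by
    intro k
    induction k with
    | zero =>
      intro x y hxy
      simp only [Nat.cast_zero, add_zero, ← Perm.eq_one_iff_card_le_cycleNum]
      have : x = 1 ↔ y = 1 := by
        constructor
        · rintro rfl
          rw [h1] at hxy
          simpa using ConjClasses.mk_eq_mk_iff_isConj.1 hxy
        · rintro rfl
          rw [← h1] at hxy
          simpa using (ConjClasses.mk_eq_mk_iff_isConj.1 (τ.injective hxy)).symm
      simp only [this]
    | succ k ih =>
      intro x y hxy
      have hsum := ClassInvariant.sum_swap_mul hτ hT ih x y hxy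
      have hxy' := ih x y hxy
      have hpos : ∀ g : Perm α, (∃ a b, a ≠ b ∧ (Fintype.card α : ℚ) ≤ (swap a b * g).cycleNum + k) ↔
          (∑ a, ∑ b, if a ≠ b then
            if (Fintype.card α : ℚ) ≤ (swap a b * g).cycleNum + k then (1 : ℚ) else 0 else 0) ≠ 0 := by
        intro g
        rw [Ne, Finset.sum_eq_zero_iff_of_nonneg fun a _ => Finset.sum_nonneg fun b _ => by
          split_ifs <;> norm_num]
        simp only [Finset.mem_univ, true_imp_iff]
        push Not
        refine exists_congr fun a => ?_
        rw [Ne, Finset.sum_eq_zero_iff_of_nonneg fun b _ => by split_ifs <;> norm_num]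
        simp
      simp only [Perm.card_le_cycleNum_add_succ_iff, hpos]
      simp only at hsum hxy'
      rw [hsum]
      simp only [hite _ _ hxy']
  intro x y hxy
  have hiff : ∀ k : ℕ, ((Fintype.card α : ℚ) ≤ x.cycleNum + k) ↔ ((Fintype.card α : ℚ) ≤ y.cycleNum + k) := by
    intro k
    exact hite _ _ (key k x y hxy)
  obtain ⟨k, hk⟩ := x.exists_cycleNum_eq
  obtain ⟨l, hl⟩ := y.exists_cycleNum_eq
  have h2 := (hiff k).1 hk.ge
  have h3 := (hiff l).2 hl.ge
  linarith

lemma ClassInvariant.sum_sameCycle_swap_mul (hτ : PreservesConvolution τ)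
    (h1 : τ (ConjClasses.mk 1) = ConjClasses.mk 1)
    (hT : ∀ s : Perm α, s.IsSwap → τ (ConjClasses.mk s) = ConjClasses.mk s)
    {F : Perm α → ℚ} (hF : ClassInvariant τ F) :
    ClassInvariant τ fun g => ∑ a, ∑ b with g.SameCycle a b,
      if a ≠ b then F (swap a b * g) else 0 := by
  classical
  have hN := classInvariant_cycleNum hτ h1 hT
  have key : ∀ g : Perm α, (∑ a, ∑ b with g.SameCycle a b, if a ≠ b then F (swap a b * g) else 0) =
      ∑ a, ∑ b, if a ≠ b then if (swap a b * g).cycleNum = g.cycleNum + 1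
        then F (swap a b * g) else 0 else 0 := by
    intro g
    refine Finset.sum_congr rfl fun a _ => ?_
    rw [Finset.sum_filter]
    refine Finset.sum_congr rfl fun b _ => ?_
    by_cases hab : a = b
    · simp [hab]
    · simp only [hab, Ne, not_false_eq_true, if_true, Perm.cycleNum_swap_mul_eq_iff hab]
  intro x y hxy
  simp only [key]
  rw [← hN x y hxy]
  refine ClassInvariant.sum_swap_mul hτ hT
    (F := fun g => if g.cycleNum = x.cycleNum + 1 then F g else 0) ?_ x y hxy
  intro z w hzw
  simp only [hN z w hzw, hF z w hzw]

lemma Equiv.Perm.sum_sameCycle_ne (g : Perm α) (a : α) (f : α → ℚ) :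
    (∑ b with g.SameCycle a b, if a ≠ b then f b else 0) =
      ∑ i ∈ range (minimalPeriod g a), if i ≠ 0 then f ((g ^ i) a) else 0 := by
  rw [sum_sameCycle]
  refine Finset.sum_congr rfl fun i hi => ?_
  have : a = (g ^ i) a ↔ i = 0 := by
    rw [eq_comm, ← pow_apply_inj_of_lt (Finset.mem_range.1 hi) (g.minimalPeriod_pos a)]
    simp
  simp only [Ne, this]

lemma classInvariant_periodSum_sub_one (hτ : PreservesConvolution τ)
    (h1 : τ (ConjClasses.mk 1) = ConjClasses.mk 1)
    (hT : ∀ s : Perm α, s.IsSwap → τ (ConjClasses.mk s) = ConjClasses.mk s) :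
    ClassInvariant τ (Equiv.Perm.periodSum (α := α) fun m => m - 1) := by
  convert ClassInvariant.sum_sameCycle_swap_mul hτ h1 hT (F := fun _ => 1) (fun _ _ _ => rfl)
    using 2 with g
  refine Finset.sum_congr rfl fun a _ => ?_
  rw [Perm.sum_sameCycle_ne]
  obtain ⟨k, hk⟩ : ∃ k, minimalPeriod g a = k + 1 :=
    ⟨minimalPeriod g a - 1, by have := g.minimalPeriod_pos a; omega⟩
  rw [hk, Finset.sum_range_succ']
  simp

/-- The operator on functions of the cycle length coming from the splitting of cycles. -/
def splitOp (h : ℕ → ℚ) (m : ℕ) : ℚ := 2 * ∑ i ∈ range m, i * h i - (m - 1) * (m * h m)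

lemma classInvariant_periodSum_splitOp (hτ : PreservesConvolution τ)
    (h1 : τ (ConjClasses.mk 1) = ConjClasses.mk 1)
    (hT : ∀ s : Perm α, s.IsSwap → τ (ConjClasses.mk s) = ConjClasses.mk s)
    {h : ℕ → ℚ} (hh : ClassInvariant τ (Equiv.Perm.periodSum (α := α) h)) :
    ClassInvariant τ (Equiv.Perm.periodSum (α := α) (splitOp h)) := by
  have key : ∀ g : Perm α, (∑ a, ∑ b with g.SameCycle a b,
      if a ≠ b then Perm.periodSum h (swap a b * g) else 0) =
      Perm.periodSum h g * Perm.periodSum (fun m => m - 1) g + Perm.periodSum (splitOp h) g := by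
    intro g
    conv_rhs => rw [Perm.periodSum.eq_def (fun m : ℕ => (m : ℚ) - 1), Finset.mul_sum,
      Perm.periodSum.eq_def (splitOp h), ← Finset.sum_add_distrib]
    refine Finset.sum_congr rfl fun a _ => ?_
    rw [Perm.sum_sameCycle_ne]
    have e : ∀ i ∈ range (minimalPeriod g a),
        (if i ≠ 0 then Perm.periodSum h (swap a ((g ^ i) a) * g) else 0) =
        if i ≠ 0 then Perm.periodSum h g - minimalPeriod g a * h (minimalPeriod g a)
          + i * h i + (minimalPeriod g a - i : ℕ) * h (minimalPeriod g a - i) else 0 := by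
      intro i hi
      refine if_ctx_congr Iff.rfl (fun h0 => ?_) fun _ => rfl
      exact Perm.periodSum_swap_mul h (Nat.pos_of_ne_zero h0) (Finset.mem_range.1 hi)
    rw [Finset.sum_congr rfl e]
    obtain ⟨k, hk⟩ : ∃ k, minimalPeriod g a = k + 1 :=
      ⟨minimalPeriod g a - 1, by have := g.minimalPeriod_pos a; omega⟩
    rw [hk, Finset.sum_range_succ', splitOp, Finset.sum_range_succ']
    simp only [ne_eq, Nat.add_eq_zero_iff, one_ne_zero, and_false, not_false_eq_true, if_true,
      not_true_eq_false, if_false, add_zero, Finset.sum_add_distrib, Finset.sum_const,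
      Finset.card_range, nsmul_eq_mul]
    have e2 : ∑ i ∈ range k, ((k + 1 - (i + 1) : ℕ) : ℚ) * h (k + 1 - (i + 1)) =
        ∑ i ∈ range k, ((i + 1 : ℕ) : ℚ) * h (i + 1) := by
      rw [← Finset.sum_range_reflect]
      refine Finset.sum_congr rfl fun i hi => ?_
      have hi := Finset.mem_range.1 hi
      rw [show k + 1 - (k - 1 - i + 1) = i + 1 by omega]
    rw [e2]
    push_cast
    ring
  have hD := ClassInvariant.sum_sameCycle_swap_mul hτ h1 hT hh
  simp only [key] at hD
  have hS := classInvariant_periodSum_sub_one hτ h1 hT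
  intro x y hxy
  have := hD x y hxy
  simp only [hh x y hxy, hS x y hxy] at this
  linarith

/-- The odd polynomial `m * (m ^ 2 - 1) * ⋯ * (m ^ 2 - k ^ 2)`. -/
def oddPoly : ℕ → ℚ → ℚ
  | 0, m => m
  | k + 1, m => oddPoly k m * (m ^ 2 - (k + 1) ^ 2)

lemma oddPoly_add_one_mul (k : ℕ) (x : ℚ) :
    oddPoly k (x + 1) * (x - k) = oddPoly k x * (x + k + 1) := by
  induction k with
  | zero => simp [oddPoly]; ring
  | succ k ih =>
    simp only [oddPoly]
    push_cast
    linear_combination (x + k + 2) * (x - k - 1) * ih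

lemma sum_mul_oddPoly (k m : ℕ) :
    2 * (2 * k + 3) * ∑ i ∈ range m, (i : ℚ) * oddPoly k i =
      oddPoly k m * (m - (k + 1)) * (2 * m - 1) := by
  induction m with
  | zero =>
    have : oddPoly k 0 = 0 := by
      induction k with
      | zero => rfl
      | succ k ih => simp [oddPoly, ih]
    simp [this]
  | succ m ih =>
    rw [Finset.sum_range_succ, mul_add, ih]
    have := oddPoly_add_one_mul k m
    push_cast
    linear_combination -(2 * (m : ℚ) + 1) * this

lemma splitOp_oddPoly (k m : ℕ) : oddPoly (k + 1) m =
    (-(2 * k + 3) / (2 * k + 1)) * (splitOp (fun m => oddPoly k m) m + k * (k + 1) * oddPoly k m) := by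
  have h := sum_mul_oddPoly k m
  have h1 : (2 * k + 1 : ℚ) ≠ 0 := by positivity
  have h3 : (2 * k + 3 : ℚ) ≠ 0 := by positivity
  rw [splitOp, oddPoly]
  field_simp
  linear_combination h

lemma oddPoly_natCast_eq_zero {k m : ℕ} (h : m ≤ k) : oddPoly k m = 0 := by
  induction k with
  | zero =>
    obtain rfl : m = 0 := by omega
    simp [oddPoly]
  | succ k ih =>
    rcases h.lt_or_eq with h | rfl
    · rw [oddPoly, ih (by omega), zero_mul]
    · simp [oddPoly]

lemma oddPoly_pos {k : ℕ} {m : ℚ} (h : (k : ℚ) < m) : 0 < oddPoly k m := by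
  induction k with
  | zero => simpa [oddPoly] using h
  | succ k ih =>
    push_cast at h
    refine mul_pos (ih (by linarith)) ?_
    have : (0 : ℚ) ≤ k := k.cast_nonneg
    nlinarith

lemma classInvariant_periodSum_oddPoly (hτ : PreservesConvolution τ)
    (h1 : τ (ConjClasses.mk 1) = ConjClasses.mk 1)
    (hT : ∀ s : Perm α, s.IsSwap → τ (ConjClasses.mk s) = ConjClasses.mk s) (k : ℕ) :
    ClassInvariant τ (Equiv.Perm.periodSum (α := α) fun m => oddPoly k m) := by
  induction k with
  | zero =>
    intro x y hxy
    have := classInvariant_periodSum_sub_one hτ h1 hT x y hxy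
    simpa [Perm.periodSum, oddPoly, Finset.sum_sub_distrib] using this
  | succ k ih =>
    have hsplit := classInvariant_periodSum_splitOp hτ h1 hT ih
    intro x y hxy
    have e1 := ih x y hxy
    have e2 := hsplit x y hxy
    simp only [Perm.periodSum] at e1 e2 ⊢
    simp only [splitOp_oddPoly, ← Finset.mul_sum, Finset.sum_add_distrib, e1, e2]

lemma classInvariant_periodSum (hτ : PreservesConvolution τ)
    (h1 : τ (ConjClasses.mk 1) = ConjClasses.mk 1)
    (hT : ∀ s : Perm α, s.IsSwap → τ (ConjClasses.mk s) = ConjClasses.mk s) (h : ℕ → ℚ)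
    (h0 : h 0 = 0) : ClassInvariant τ (Equiv.Perm.periodSum (α := α) h) := by
  intro x y hxy
  have key : ∀ d M : ℕ, Fintype.card α ≤ M + d → ∀ h : ℕ → ℚ, (∀ m ≤ M, h m = 0) →
      Perm.periodSum h x = Perm.periodSum h y := by
    intro d
    induction d with
    | zero =>
      intro M hM h hh
      have hzero : ∀ g : Perm α, Perm.periodSum h g = 0 := fun g =>
        Finset.sum_eq_zero fun a _ => hh _ ((Function.minimalPeriod_le_card).trans hM)
      rw [hzero, hzero]
    | succ d ih =>
      intro M hM h hh
      have hpos : (0 : ℚ) < oddPoly M (M + 1 : ℕ) := oddPoly_pos (by push_cast; linarith)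
      have := ih (M + 1) (by omega)
        (fun m => h m - h (M + 1) / oddPoly M (M + 1 : ℕ) * oddPoly M m) ?_
      · simp only [Perm.periodSum, Finset.sum_sub_distrib, ← Finset.mul_sum] at this
        have e := classInvariant_periodSum_oddPoly hτ h1 hT M x y hxy
        simp only [Perm.periodSum] at e ⊢
        rw [e] at this
        linarith
      · intro m hm
        rcases hm.lt_or_eq with hm | rfl
        · simp [hh m (by omega), oddPoly_natCast_eq_zero (show m ≤ M by omega)]
        · simp only [div_mul_cancel₀ _ hpos.ne', sub_self]
  exact key (Fintype.card α) 0 (by simp) h (by simpa using h0)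

end Invariance

lemma Equiv.Perm.minimalPeriod_eq_card_support_cycleOf {g : Perm α} {x : α} (hx : g x ≠ x) :
    minimalPeriod g x = #(g.cycleOf x).support := by
  have h := sum_sameCycle g x fun _ => 1
  have e : (g.cycleOf x).support = univ.filter (g.SameCycle x) := by
    ext y
    simp [mem_support_cycleOf_iff' hx]
  rw [e]
  simpa [eq_comm] using h

lemma Equiv.Perm.card_minimalPeriod_eq (g : Perm α) {m : ℕ} (hm : 2 ≤ m) :
    #{x | minimalPeriod g x = m} = m * g.cycleType.count m := by
  have hne : ∀ x, minimalPeriod g x = m → g x ≠ x := by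
    intro x hx h
    have := Function.minimalPeriod_eq_one_iff_isFixedPt.2 h
    omega
  rw [Finset.card_eq_sum_card_fiberwise (f := g.cycleOf)
    (t := g.cycleFactorsFinset.filter fun c => #c.support = m)]
  · rw [Finset.sum_congr rfl (g := fun _ => m)]
    · rw [Finset.sum_const, smul_eq_mul, mul_comm, cycleType_def, Multiset.count_map]
      simp only [eq_comm, Function.comp_apply, Finset.card_def, Finset.filter_val]
      congr!
    · intro c hc
      rw [Finset.mem_filter] at hc
      rw [← hc.2]
      congr 1
      ext x
      simp only [Finset.mem_filter, Finset.mem_univ, true_and]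
      constructor
      · rintro ⟨hx, rfl⟩
        rw [mem_support_cycleOf_iff]
        exact ⟨SameCycle.refl _ _, by simpa using hne x (hx.trans hc.2)⟩
      · intro hx
        have e := cycle_is_cycleOf hx hc.1
        refine ⟨?_, e.symm⟩
        rw [minimalPeriod_eq_card_support_cycleOf, ← e]
        simpa using (mem_cycleFactorsFinset_support_le hc.1) hx
  · intro x hx
    have hx : minimalPeriod g x = m := by simpa using hx
    have := hne x hx
    simp [cycleOf_mem_cycleFactorsFinset_iff, this, ← minimalPeriod_eq_card_support_cycleOf this, hx]

/-- A permutation of the conjugacy classes which is compatible with convolution and fixes the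
identity and the transpositions is trivial. -/
lemma PreservesConvolution.eq_one {τ : Perm (ConjClasses (Perm α))} (hτ : PreservesConvolution τ)
    (h1 : τ (ConjClasses.mk 1) = ConjClasses.mk 1)
    (hT : ∀ s : Perm α, s.IsSwap → τ (ConjClasses.mk s) = ConjClasses.mk s) : τ = 1 := by
  ext c
  obtain ⟨x, rfl⟩ := ConjClasses.exists_rep c
  obtain ⟨y, hy⟩ := ConjClasses.exists_rep (τ (ConjClasses.mk x))
  rw [Perm.one_apply]
  refine Eq.trans hy.symm (ConjClasses.mk_eq_mk_iff_isConj.2 (Perm.isConj_of_cycleType_eq ?_))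
  ext m
  by_cases hm : 2 ≤ m
  · have := classInvariant_periodSum hτ h1 hT (fun k => if k = m then 1 else 0)
      (if_neg (by omega)) x y hy
    simp only [Perm.periodSum, Finset.sum_boole, Perm.card_minimalPeriod_eq _ hm] at this
    have h' := Nat.eq_of_mul_eq_mul_left (by omega) (Nat.cast_injective this)
    exact h'.symm
  · rw [Multiset.count_eq_zero_of_notMem fun h => hm (Perm.two_le_of_mem_cycleType h),
      Multiset.count_eq_zero_of_notMem fun h => hm (Perm.two_le_of_mem_cycleType h)]

end Transpositions

section CentralizerOrder

open Equiv Finset Nat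

/-- The order of the centralizer of a permutation of `n` points with cycle type `M`. -/
def centralizerOrder (n : ℕ) (M : Multiset ℕ) : ℕ :=
  (n - M.sum)! * M.prod * ∏ k ∈ M.toFinset, (M.count k)!

lemma centralizerOrder_le {n : ℕ} {M : Multiset ℕ} (hM : ∀ a ∈ M, 2 ≤ a) (hn : M.sum ≤ n) :
    centralizerOrder n M ≤ n ! := by
  have h := Perm.card_of_cycleType_mul_eq (Fin n) M
  rw [if_pos (by simpa using ⟨hn, hM⟩), Fintype.card_fin] at h
  exact Nat.le_of_dvd n.factorial_pos (Dvd.intro_left _ h)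

lemma centralizerOrder_cons (n i : ℕ) (M : Multiset ℕ) :
    centralizerOrder n (i ::ₘ M) = i * (M.count i + 1) * centralizerOrder (n - i) M := by
  have h1 : ∏ k ∈ M.toFinset, (M.count k)! = ∏ k ∈ insert i M.toFinset, (M.count k)! := by
    refine Finset.prod_subset (Finset.subset_insert _ _) fun k _ hk => ?_
    rw [Multiset.count_eq_zero_of_notMem (by simpa using hk), Nat.factorial_zero]
  have h2 : ∏ k ∈ insert i M.toFinset, ((i ::ₘ M).count k)! =
      (M.count i + 1) * ∏ k ∈ insert i M.toFinset, (M.count k)! := by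
    rw [← Finset.mul_prod_erase _ _ (Finset.mem_insert_self i _),
      ← Finset.mul_prod_erase _ (fun k => (M.count k)!) (Finset.mem_insert_self i _),
      Multiset.count_cons_self, Nat.factorial_succ, mul_assoc]
    congr 2
    refine Finset.prod_congr rfl fun k hk => ?_
    rw [Multiset.count_cons_of_ne (Finset.ne_of_mem_erase hk)]
  rw [centralizerOrder, centralizerOrder, Multiset.toFinset_cons, h2, h1, Multiset.sum_cons,
    Multiset.prod_cons, Nat.sub_add_eq]
  ring

lemma Multiset.mul_count_le_sum (M : Multiset ℕ) (i : ℕ) : i * M.count i ≤ M.sum := by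
  have h : Multiset.replicate (M.count i) i ≤ M := Multiset.le_count_iff_replicate_le.1 le_rfl
  obtain ⟨N, hN⟩ := Multiset.le_iff_exists_add.1 h
  have := congrArg Multiset.sum hN
  rw [Multiset.sum_add, Multiset.sum_replicate, smul_eq_mul] at this
  lia

lemma centralizerOrder_replicate_two {m : ℕ} (hm : m ≠ 0) (n : ℕ) :
    centralizerOrder n (Multiset.replicate m 2) = (n - 2 * m)! * 2 ^ m * m ! := by
  rw [centralizerOrder, Multiset.toFinset_replicate, if_neg hm]
  simp [mul_comm]

lemma two_pow_mul_factorial_lt {m : ℕ} (hm : 4 ≤ m) : 2 ^ m * m ! < 2 * (2 * m - 2)! := by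
  induction m, hm using Nat.le_induction with
  | base => decide
  | succ m hm ih =>
    obtain ⟨k, rfl⟩ : ∃ k, m = k + 4 := ⟨m - 4, by omega⟩
    rw [show 2 * (k + 4 + 1) - 2 = (2 * (k + 4) - 2) + 1 + 1 by omega,
      Nat.factorial_succ (k + 4), Nat.factorial_succ (2 * (k + 4) - 2 + 1),
      Nat.factorial_succ (2 * (k + 4) - 2), pow_succ]
    set A := (2 * (k + 4) - 2)!
    set B := 2 ^ (k + 4)
    set C := (k + 4)!
    rw [show 2 * (k + 4) - 2 + 1 = 2 * k + 7 by omega]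
    nlinarith [Nat.zero_le (k * A), Nat.zero_le (k * k * A), Nat.zero_le A]

lemma centralizerOrder_eq_swap {n : ℕ} (h4 : n ≠ 4) {M : Multiset ℕ} (hM : ∀ a ∈ M, 2 ≤ a)
    (hM0 : M ≠ 0) (hn : M.sum ≤ n) (h : centralizerOrder n M = 2 * (n - 2)!) :
    M = {2} ∨ n = 6 ∧ M = Multiset.replicate 3 2 := by
  by_cases h2 : ∀ a ∈ M, a = 2
  · obtain ⟨m, rfl⟩ : ∃ m, M = Multiset.replicate m 2 := ⟨_, Multiset.eq_replicate_card.2 h2⟩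
    have hm : m ≠ 0 := by rintro rfl; simp at hM0
    rw [centralizerOrder_replicate_two hm] at h
    have hmn : 2 * m ≤ n := by simpa [mul_comm] using hn
    obtain ⟨k, rfl⟩ := Nat.exists_eq_add_of_le hmn
    rw [Nat.add_sub_cancel_left] at h
    have hk := k.factorial_pos
    rcases (show m = 1 ∨ m = 2 ∨ m = 3 ∨ 4 ≤ m by omega) with rfl | rfl | rfl | hm4
    · exact Or.inl rfl
    · exfalso
      rw [show 2 * 2 + k - 2 = k + 1 + 1 by omega, Nat.factorial_succ, Nat.factorial_succ] at h
      have : (k + 2) * (k + 1) = 4 := by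
        refine Nat.eq_of_mul_eq_mul_right hk ?_
        simp [Nat.factorial] at h
        lia
      rcases k with _ | k
      · simp at this
      · nlinarith
    · right
      rw [show 2 * 3 + k - 2 = k + 1 + 1 + 1 + 1 by omega, Nat.factorial_succ, Nat.factorial_succ,
        Nat.factorial_succ, Nat.factorial_succ] at h
      have : (k + 4) * (k + 3) * (k + 2) * (k + 1) = 24 := by
        refine Nat.eq_of_mul_eq_mul_right hk ?_
        simp [Nat.factorial] at h
        lia
      rcases k with _ | k
      · exact ⟨rfl, rfl⟩
      · ring_nf at this
        lia
    · exfalso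
      have h1 := two_pow_mul_factorial_lt hm4
      have h3 := Nat.le_of_dvd (Nat.factorial_pos _)
        (Nat.factorial_mul_factorial_dvd_factorial_add k (2 * m - 2))
      rw [show k + (2 * m - 2) = 2 * m + k - 2 by omega] at h3
      nlinarith
  · exfalso
    push Not at h2
    obtain ⟨i, hi, hi2⟩ := h2
    have hi3 : 3 ≤ i := by have := hM i hi; omega
    obtain ⟨M, rfl⟩ := Multiset.exists_cons_of_mem hi
    have hsum : i + M.sum ≤ n := by simpa using hn
    have hcount := Multiset.mul_count_le_sum (i ::ₘ M) i
    rw [Multiset.count_cons_self] at hcount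
    rw [centralizerOrder_cons] at h
    have hle : centralizerOrder (n - i) M ≤ (n - i)! :=
      centralizerOrder_le (fun a ha => hM a (Multiset.mem_cons_of_mem ha)) (by omega)
    have hle' : (n - i)! ≤ (n - 3)! := Nat.factorial_le (by omega)
    have hle2 : 2 * (n - 2)! ≤ n * (n - 3)! := h ▸ Nat.mul_le_mul (by omega) (hle.trans hle')
    by_cases hn3 : n = 3
    · subst hn3
      obtain rfl : i = 3 := by omega
      have : 3 ∣ 2 * (3 - 2)! := h ▸ Dvd.intro _ (mul_assoc _ _ _).symm
      revert this
      decide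
    · obtain ⟨k, rfl⟩ := Nat.exists_eq_add_of_le (show 5 ≤ n by omega)
      rw [show 5 + k - 2 = 5 + k - 3 + 1 by omega, Nat.factorial_succ] at hle2
      have := (5 + k - 3).factorial_pos
      rw [show 5 + k - 3 = k + 2 by omega] at *
      nlinarith

/-- A nontrivial conjugacy class of the size of the class of transpositions is the class of
transpositions, or `n = 6` and it is the class of triple transpositions. -/
lemma Equiv.Perm.isSwap_or_of_card_conjClass_eq {n : ℕ} (h4 : n ≠ 4) {s g : Perm (Fin n)}
    (hs : s.IsSwap) (hg : g ≠ 1) (h : Nat.card {x | ConjClasses.mk x = ConjClasses.mk s} =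
      Nat.card {x | ConjClasses.mk x = ConjClasses.mk g}) :
    g.IsSwap ∨ n = 6 ∧ g.cycleType = Multiset.replicate 3 2 := by
  have key : ∀ x : Perm (Fin n), Nat.card {y | ConjClasses.mk y = ConjClasses.mk x} *
      centralizerOrder n x.cycleType = n ! := by
    intro x
    have := card_isConj_mul_eq x
    rw [Fintype.card_fin] at this
    simpa only [ConjClasses.mk_eq_mk_iff_isConj, isConj_comm (h := x), centralizerOrder] using this
  have hsg : centralizerOrder n s.cycleType = centralizerOrder n g.cycleType := by
    have h1 := key s
    rw [h, ← key g] at h1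
    refine Nat.eq_of_mul_eq_mul_left (Nat.pos_of_ne_zero fun h0 => ?_) h1
    have := key g
    rw [h0, zero_mul] at this
    exact n.factorial_ne_zero this.symm
  rw [isSwap_iff_cycleType.1 hs, ← Multiset.replicate_one, centralizerOrder_replicate_two one_ne_zero] at hsg
  rw [isSwap_iff_cycleType]
  refine centralizerOrder_eq_swap h4 (fun a => two_le_of_mem_cycleType)
    (by rwa [Ne, cycleType_eq_zero]) (by simpa using g.sum_cycleType_le) ?_
  rw [← hsg]
  simp [mul_comm]

end CentralizerOrder

section OuterAutomorphism

open Equiv Finset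

/-- The six synthematic totals: the partitions of the fifteen pairs of elements of `Fin 6` into
five perfect matchings, each matching being given as a fixed-point-free involution. -/
def synthematicTotal : Fin 6 → Finset (Fin 6 → Fin 6) :=
  ![{![1, 0, 3, 2, 5, 4], ![2, 4, 0, 5, 1, 3], ![3, 5, 4, 0, 2, 1], ![4, 3, 5, 1, 0, 2], ![5, 2, 1, 4, 3, 0]},
    {![1, 0, 3, 2, 5, 4], ![2, 5, 0, 4, 3, 1], ![3, 4, 5, 0, 1, 2], ![4, 2, 1, 5, 0, 3], ![5, 3, 4, 1, 2, 0]},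
    {![1, 0, 4, 5, 2, 3], ![2, 3, 0, 1, 5, 4], ![3, 4, 5, 0, 1, 2], ![4, 5, 3, 2, 0, 1], ![5, 2, 1, 4, 3, 0]},
    {![1, 0, 4, 5, 2, 3], ![2, 5, 0, 4, 3, 1], ![3, 2, 1, 0, 5, 4], ![4, 3, 5, 1, 0, 2], ![5, 4, 3, 2, 1, 0]},
    {![1, 0, 5, 4, 3, 2], ![2, 3, 0, 1, 5, 4], ![3, 5, 4, 0, 2, 1], ![4, 2, 1, 5, 0, 3], ![5, 4, 3, 2, 1, 0]},
    {![1, 0, 5, 4, 3, 2], ![2, 4, 0, 5, 1, 3], ![3, 2, 1, 0, 5, 4], ![4, 5, 3, 2, 0, 1], ![5, 3, 4, 1, 2, 0]}]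

lemma synthematicTotal_injective : Function.Injective synthematicTotal := by decide

/-- The action of a permutation on the sets of self-maps of `Fin 6`, by conjugation. -/
def conjImage (g : Perm (Fin 6)) (s : Finset (Fin 6 → Fin 6)) : Finset (Fin 6 → Fin 6) :=
  s.image fun f => g ∘ f ∘ g.symm

lemma conjImage_mul (g h : Perm (Fin 6)) (s : Finset (Fin 6 → Fin 6)) :
    conjImage (g * h) s = conjImage g (conjImage h s) := by
  rw [conjImage, conjImage, conjImage, Finset.image_image]
  rfl

lemma conjImage_one (s : Finset (Fin 6 → Fin 6)) : conjImage 1 s = s := by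
  ext f
  simp [conjImage, Perm.one_def]

lemma exists_conjImage_swap_synthematicTotal (k : Fin 5) (i : Fin 6) :
    ∃ j, conjImage (swap k.castSucc k.succ) (synthematicTotal i) = synthematicTotal j := by
  revert k i
  decide

lemma exists_conjImage_synthematicTotal (g : Perm (Fin 6)) (i : Fin 6) :
    ∃ j, conjImage g (synthematicTotal i) = synthematicTotal j := by
  have hg : g ∈ Submonoid.closure (Set.range fun k : Fin 5 => swap k.castSucc k.succ) := by
    rw [Perm.mclosure_swap_castSucc_succ]
    trivial
  induction hg using Submonoid.closure_induction generalizing i with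
  | mem g hg =>
    obtain ⟨k, rfl⟩ := hg
    exact exists_conjImage_swap_synthematicTotal k i
  | one => exact ⟨i, conjImage_one _⟩
  | mul g h _ _ ihg ihh =>
    obtain ⟨j, hj⟩ := ihh i
    obtain ⟨k, hk⟩ := ihg j
    exact ⟨k, by rw [conjImage_mul, hj, hk]⟩

/-- The action of the permutations of `Fin 6` on the synthematic totals. -/
noncomputable def synthematicAction : Perm (Fin 6) →* Perm (Fin 6) :=
  MonoidHom.toHomPerm
    { toFun := fun g i => (exists_conjImage_synthematicTotal g i).choose
      map_one' := funext fun i => synthematicTotal_injective <| by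
        rw [← (exists_conjImage_synthematicTotal 1 i).choose_spec, conjImage_one]
        rfl
      map_mul' := fun g h => funext fun i => synthematicTotal_injective <| by
        rw [← (exists_conjImage_synthematicTotal (g * h) i).choose_spec, conjImage_mul,
          (exists_conjImage_synthematicTotal h i).choose_spec]
        exact (exists_conjImage_synthematicTotal g _).choose_spec }

lemma synthematicTotal_synthematicAction (g : Perm (Fin 6)) (i : Fin 6) :
    synthematicTotal (synthematicAction g i) = conjImage g (synthematicTotal i) :=
  (exists_conjImage_synthematicTotal g i).choose_spec.symm

lemma forall_mem_five {α : Type*} [DecidableEq α] {p : α → Prop} {a b c d e : α}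
    (ha : p a) (hb : p b) (hc : p c) (hd : p d) (he : p e) :
    ∀ x ∈ ({a, b, c, d, e} : Finset α), p x := by
  simp [ha, hb, hc, hd, he]

lemma exists_mem_inter_synthematicTotal (i : Fin 6) :
    ∀ f ∈ synthematicTotal i, ∃ j, f ∈ synthematicTotal j ∧
      ∀ f' ∈ synthematicTotal i, f' ∈ synthematicTotal j → f' = f := by
  fin_cases i
  all_goals refine forall_mem_five ?_ ?_ ?_ ?_ ?_
  all_goals
    first
    | exact ⟨0, by decide, forall_mem_five (by decide) (by decide) (by decide) (by decide)
        (by decide)⟩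
    | exact ⟨1, by decide, forall_mem_five (by decide) (by decide) (by decide) (by decide)
        (by decide)⟩
    | exact ⟨2, by decide, forall_mem_five (by decide) (by decide) (by decide) (by decide)
        (by decide)⟩
    | exact ⟨3, by decide, forall_mem_five (by decide) (by decide) (by decide) (by decide)
        (by decide)⟩
    | exact ⟨4, by decide, forall_mem_five (by decide) (by decide) (by decide) (by decide)
        (by decide)⟩
    | exact ⟨5, by decide, forall_mem_five (by decide) (by decide) (by decide) (by decide)
        (by decide)⟩

lemma exists_mem_synthematicTotal_apply_ne {a b : Fin 6} (hab : a ≠ b) :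
    ∃ i j, ∃ f ∈ synthematicTotal i, ∃ f' ∈ synthematicTotal j, f a = f' a ∧ f b ≠ f' b := by
  revert a b
  decide

lemma synthematicAction_injective : Function.Injective synthematicAction := by
  rw [injective_iff_map_eq_one]
  intro g hg
  have h1 : ∀ i, conjImage g (synthematicTotal i) = synthematicTotal i := by
    intro i
    rw [← synthematicTotal_synthematicAction, hg, Perm.one_apply]
  have h2 : ∀ i, ∀ f ∈ synthematicTotal i, ∀ x, g (f x) = f (g x) := by
    intro i f hf x
    obtain ⟨j, hfj, hj⟩ := exists_mem_inter_synthematicTotal i f hf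
    have hmem : ∀ k, f ∈ synthematicTotal k → g ∘ f ∘ g.symm ∈ synthematicTotal k := by
      intro k hk
      rw [← h1 k]
      exact Finset.mem_image_of_mem _ hk
    simpa using congrFun (hj _ (hmem i hf) (hmem j hfj)) (g x)
  ext1 a
  by_contra hne
  obtain ⟨i, j, f, hf, f', hf', hfa, hfb⟩ :=
    exists_mem_synthematicTotal_apply_ne (a := a) (b := g a) (fun h => hne h.symm)
  exact hfb (by rw [← h2 i f hf, ← h2 j f' hf', hfa])

lemma synthematicAction_swap_apply_ne (i : Fin 6) : synthematicAction (swap 0 1) i ≠ i := by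
  intro h
  have h1 := synthematicTotal_synthematicAction (swap 0 1) i
  rw [h] at h1
  clear h
  revert i
  decide

/-- The symmetric group of degree six has an automorphism which does not preserve the
transpositions. -/
lemma exists_mulEquiv_perm_fin_six_not_isSwap :
    ∃ φ : Perm (Fin 6) ≃* Perm (Fin 6), ∀ s : Perm (Fin 6), s.IsSwap → ¬ (φ s).IsSwap := by
  refine ⟨MulEquiv.ofBijective synthematicAction
    (Finite.injective_iff_bijective.1 synthematicAction_injective), ?_⟩
  intro s hs hφ
  obtain ⟨k, hk⟩ := isConj_iff.1 (Perm.isConj_of_cycleType_eq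
    ((Perm.isSwap_iff_cycleType.1 hs).trans
      (Perm.isSwap_iff_cycleType.1 (Perm.swap_isSwap_iff.2 (show (0 : Fin 6) ≠ 1 by decide))).symm))
  have hk' := congrArg synthematicAction hk
  rw [map_mul, map_mul, map_inv] at hk'
  have hswap : (synthematicAction (swap 0 1)).IsSwap := by
    rw [← hk', Perm.isSwap_iff_cycleType, Perm.cycleType_conj]
    exact Perm.isSwap_iff_cycleType.1 hφ
  have hcard := Perm.card_support_eq_two.2 hswap
  have huniv : (synthematicAction (swap 0 1)).support = univ := by
    ext i
    simpa using synthematicAction_swap_apply_ne i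
  rw [huniv] at hcard
  simp at hcard

end OuterAutomorphism

lemma IsTableAut.exists_mulEquiv_of_conjClasses_eq {G : Type} [Group G]
    {σ : Equiv.Perm {f : G → ℂ // IsIrrChar G f}} {τ : Equiv.Perm (ConjClasses G)}
    (h : IsTableAut G σ τ) (φ : G ≃* G) (hφ : τ = φ.conjClasses) :
    ∃ φ : G ≃* G, (∀ g : G, τ (ConjClasses.mk g) = ConjClasses.mk (φ g)) ∧
      ∀ (f : {f : G → ℂ // IsIrrChar G f}) (g : G), (σ f).1 g = f.1 (φ.symm g) := by
  subst hφ
  exact ⟨φ, fun g => rfl, fun f g => h f (φ.symm g) g (by simp [MulEquiv.conjClasses_mk])⟩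

/-- The class of the transpositions is fixed as soon as some transposition is sent to the class of
a transposition. -/
lemma Equiv.Perm.mk_eq_of_isSwap {α : Type} [Fintype α] [DecidableEq α]
    {τ : Equiv.Perm (ConjClasses (Equiv.Perm α))} {s g : Equiv.Perm α} (hs : s.IsSwap)
    (hg : g.IsSwap) (h : ConjClasses.mk g = τ (ConjClasses.mk s)) :
    ∀ t : Equiv.Perm α, t.IsSwap → τ (ConjClasses.mk t) = ConjClasses.mk t := by
  have hconj : ∀ t t' : Equiv.Perm α, t.IsSwap → t'.IsSwap →
      ConjClasses.mk t = ConjClasses.mk t' := fun t t' ht ht' =>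
    ConjClasses.mk_eq_mk_iff_isConj.2 (isConj_of_cycleType_eq
      ((isSwap_iff_cycleType.1 ht).trans (isSwap_iff_cycleType.1 ht').symm))
  intro t ht
  rw [hconj t s ht hs, ← h, hconj g s hg hs]

lemma PreservesConvolution.exists_eq_conjClasses {n : ℕ} (h4 : n ≠ 4)
    {τ : Equiv.Perm (ConjClasses (Equiv.Perm (Fin n)))} (hτ : PreservesConvolution τ)
    (h1 : τ (ConjClasses.mk 1) = ConjClasses.mk 1) :
    ∃ φ : Equiv.Perm (Fin n) ≃* Equiv.Perm (Fin n), τ = φ.conjClasses := by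
  have hrefl : (MulEquiv.refl (Equiv.Perm (Fin n))).conjClasses = 1 := by
    ext c
    obtain ⟨g, rfl⟩ := ConjClasses.exists_rep c
    rfl
  have hmk1 : ∀ g : Equiv.Perm (Fin n), ConjClasses.mk g = ConjClasses.mk 1 → g = 1 := by
    intro g hg
    simpa using ConjClasses.mk_eq_mk_iff_isConj.1 hg
  have himage : ∀ {τ : Equiv.Perm (ConjClasses (Equiv.Perm (Fin n)))}, PreservesConvolution τ →
      τ (ConjClasses.mk 1) = ConjClasses.mk 1 → ∀ {s g : Equiv.Perm (Fin n)}, s.IsSwap →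
      ConjClasses.mk g = τ (ConjClasses.mk s) →
      g.IsSwap ∨ n = 6 ∧ g.cycleType = Multiset.replicate 3 2 := by
    intro τ hτ h1 s g hs hg
    refine Equiv.Perm.isSwap_or_of_card_conjClass_eq h4 hs ?_ (by rw [hg]; exact hτ.card_eq _)
    rintro rfl
    rw [← h1] at hg
    have := hmk1 s (τ.injective hg).symm
    rw [Equiv.Perm.isSwap_iff_cycleType, this] at hs
    simp at hs
  by_cases hex : ∃ s : Equiv.Perm (Fin n), s.IsSwap
  · obtain ⟨s, hs⟩ := hex
    obtain ⟨g, hg⟩ := ConjClasses.exists_rep (τ (ConjClasses.mk s))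
    rcases himage hτ h1 hs hg with hg' | ⟨rfl, hg'⟩
    · exact ⟨MulEquiv.refl _, hrefl ▸ hτ.eq_one h1 (Equiv.Perm.mk_eq_of_isSwap hs hg' hg)⟩
    · obtain ⟨φ, hφ⟩ := exists_mulEquiv_perm_fin_six_not_isSwap
      have hφ1 : φ.conjClasses (ConjClasses.mk 1) = ConjClasses.mk 1 := by
        rw [MulEquiv.conjClasses_mk, map_one]
      have hφs : (φ s).cycleType = Multiset.replicate 3 2 :=
        ((himage φ.preservesConvolution_conjClasses hφ1 hs rfl).resolve_left (hφ s hs)).2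
      have hgφ : ConjClasses.mk g = ConjClasses.mk (φ s) :=
        ConjClasses.mk_eq_mk_iff_isConj.2 (Equiv.Perm.isConj_of_cycleType_eq (hg'.trans hφs.symm))
      have hsymm : ∀ x, φ.symm.conjClasses (ConjClasses.mk (φ x)) = ConjClasses.mk x := fun x => by
        rw [MulEquiv.conjClasses_mk, MulEquiv.symm_apply_apply]
      have hone : τ.trans φ.symm.conjClasses = 1 := by
        refine (hτ.trans φ.symm.preservesConvolution_conjClasses).eq_one ?_
          (Equiv.Perm.mk_eq_of_isSwap hs hs ?_)
        · rw [Equiv.trans_apply, h1, MulEquiv.conjClasses_mk, map_one]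
        · rw [Equiv.trans_apply, ← hg]
          exact (hsymm s).symm.trans (congrArg _ hgφ.symm)
      refine ⟨φ, Equiv.ext fun c => ?_⟩
      have hc : φ.symm.conjClasses (τ c) = c := DFunLike.congr_fun hone c
      exact (Equiv.symm_apply_eq φ.conjClasses).1 hc
  · refine ⟨MulEquiv.refl _, hrefl ▸ hτ.eq_one h1 fun s hs => absurd ⟨s, hs⟩ hex⟩

theorem table_aut_symmetricGroup_induced_by_automorphism (n : ℕ) (h4 : n ≠ 4)
    (σ : Equiv.Perm {f : Equiv.Perm (Fin n) → ℂ // IsIrrChar (Equiv.Perm (Fin n)) f})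
    (τ : Equiv.Perm (ConjClasses (Equiv.Perm (Fin n))))
    (h : IsTableAut (Equiv.Perm (Fin n)) σ τ) :
    ∃ φ : Equiv.Perm (Fin n) ≃* Equiv.Perm (Fin n),
      (∀ g : Equiv.Perm (Fin n), τ (ConjClasses.mk g) = ConjClasses.mk (φ g)) ∧
      (∀ (f : {f : Equiv.Perm (Fin n) → ℂ // IsIrrChar (Equiv.Perm (Fin n)) f})
        (g : Equiv.Perm (Fin n)), (σ f).1 g = f.1 (φ.symm g)) := by
  classical
  obtain ⟨φ, hφ⟩ := h.preservesConvolution.exists_eq_conjClasses h4 h.map_one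
  exact h.exists_mulEquiv_of_conjClasses_eq φ hφ
end
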